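/- arXiv:1612.06638 — 3 statements merged into one kernel-verified Lean document; each statement's English description precedes it below -/
import Mathlib

section
/- Let V be the vertex set of a median graph, and fix x₀, x ∈ V and an integer n ≥ 1 with d_nor(x₀,x) ≥ n; let H_n and F_h be as defined. Let h ∈ H_n, suppose F_h is nonempty, and let x_h ∈ F_h be a point at which d(x₀,·) attains its minimum over F_h. Then x_h is the unique point w ∈ B_nor(x₀,n) such that w ∉ h and such that no halfspace crossing h separates w from x₀ (i.e., for every halfspace k crossing h one has w ∈ k if and only if x₀ ∈ k). -/
open scoped ENNReal

namespace MedianGraph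

variable {V : Type*}

/-- The metric interval `[x,y]` in a graph with respect to the edge-path metric. -/
def itv (G : SimpleGraph V) (x y : V) : Set V :=
  {z | G.dist x z + G.dist z y = G.dist x y}

/-- A subset of the vertex set is convex if it contains every interval between
two of its points. -/
def Cvx (G : SimpleGraph V) (S : Set V) : Prop :=
  ∀ a ∈ S, ∀ b ∈ S, itv G a b ⊆ S

/-- A median graph: a connected graph in which every triple of vertices has a
unique median. -/
def IsMedianGraph (G : SimpleGraph V) : Prop :=
  G.Connected ∧ ∀ x y z : V, ∃! m : V,
    m ∈ itv G x y ∧ m ∈ itv G y z ∧ m ∈ itv G z x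

/-- A halfspace: a subset which is nonempty, proper, convex with convex complement. -/
def IsHalfspace (G : SimpleGraph V) (h : Set V) : Prop :=
  h.Nonempty ∧ hᶜ.Nonempty ∧ Cvx G h ∧ Cvx G hᶜ

/-- `Hset G x y` is the set of halfspaces containing `x` but not `y`. -/
def Hset (G : SimpleGraph V) (x y : V) : Set (Set V) :=
  {h | IsHalfspace G h ∧ x ∈ h ∧ y ∉ h}

/-- The normal distance `d_nor(x,y)`: the maximum cardinality of a chain (under
inclusion) in `Hset G x y`. -/
noncomputable def dnor (G : SimpleGraph V) (x y : V) : ℕ :=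
  sSup {n : ℕ | ∃ c : Set (Set V), c ⊆ Hset G x y ∧ IsChain (· ⊆ ·) c ∧ c.encard = n}

/-- Two halfspaces cross if all four intersections of them and their
complements are nonempty. -/
def Crosses (h k : Set V) : Prop :=
  (h ∩ k).Nonempty ∧ (h ∩ kᶜ).Nonempty ∧ (hᶜ ∩ k).Nonempty ∧ (hᶜ ∩ kᶜ).Nonempty

/-- `Hn G x₀ x n`: the halfspaces `h` in `Hset G x₀ x` such that the maximum
cardinality of a chain in `{k ∈ H(x₀,x) : k ⊆ h}` equals `n`. -/
noncomputable def Hn (G : SimpleGraph V) (x₀ x : V) (n : ℕ) : Set (Set V) :=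
  {h | h ∈ Hset G x₀ x ∧
    sSup {m : ℕ | ∃ c : Set (Set V), c ⊆ {k | k ∈ Hset G x₀ x ∧ k ⊆ h} ∧
      IsChain (· ⊆ ·) c ∧ c.encard = m} = n}

/-- `Fh G x₀ x n h = {w ∈ [x₀,x] ∩ S_nor(x₀,n) : w ∉ h}`. -/
def Fh (G : SimpleGraph V) (x₀ x : V) (n : ℕ) (h : Set V) : Set V :=
  {w | w ∈ itv G x₀ x ∧ dnor G x₀ w = n ∧ w ∉ h}

/-- The graph has dimension at most `η` if every family of pairwise crossing
halfspaces has cardinality at most `η`. -/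
def DimLE (G : SimpleGraph V) (η : ℕ) : Prop :=
  ∀ F : Set (Set V), (∀ h ∈ F, IsHalfspace G h) →
    (∀ h ∈ F, ∀ k ∈ F, h ≠ k → Crosses h k) → F.encard ≤ η

end MedianGraph

open MedianGraph

namespace MedianGraph

variable {V : Type*}

/-- Points closer to `a` than to its neighbour `b`. -/
def WW (G : SimpleGraph V) (a b : V) : Set V := {z | G.dist z b = G.dist z a + 1}

theorem exists_next {G : SimpleGraph V} (hc : G.Connected) {z t : V} (hne : z ≠ t) :
    ∃ u, G.dist z u = 1 ∧ G.dist z t = 1 + G.dist u t := by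
  obtain ⟨p, hp⟩ := hc.exists_walk_length_eq_dist z t
  cases p with
  | nil => exact absurd rfl hne
  | @cons _ u _ hadj q =>
    refine ⟨u, SimpleGraph.dist_eq_one_iff_adj.2 hadj, ?_⟩
    have h1 := SimpleGraph.dist_le q
    have h2 := hc.dist_triangle (u := z) (v := u) (w := t)
    have h3 : G.dist z u = 1 := SimpleGraph.dist_eq_one_iff_adj.2 hadj
    simp only [SimpleGraph.Walk.length_cons] at hp
    omega

/-- Dichotomy for an edge. -/
theorem edge_dich {G : SimpleGraph V} (hG : IsMedianGraph G) {a b : V} (hab : G.dist a b = 1)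
    (z : V) : G.dist z b = G.dist z a + 1 ∨ G.dist z a = G.dist z b + 1 := by
  obtain ⟨m, ⟨h1, h2, h3⟩, -⟩ := hG.2 a b z
  simp only [itv, Set.mem_ofPred_eq] at h1 h2 h3
  have hc := hG.1
  rcases Nat.eq_zero_or_pos (G.dist a m) with h0 | h0
  · rw [hc.dist_eq_zero_iff] at h0
    subst h0
    left
    have := G.dist_comm (u := a) (v := b)
    have := G.dist_comm (u := a) (v := z)
    have := G.dist_comm (u := b) (v := z)
    omega
  · have h0' : G.dist m b = 0 := by omega
    rw [hc.dist_eq_zero_iff] at h0'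
    subst h0'
    right
    have := G.dist_comm (u := a) (v := m)
    have := G.dist_comm (u := m) (v := z)
    have := G.dist_comm (u := a) (v := z)
    omega

theorem WW_step {G : SimpleGraph V} (hG : IsMedianGraph G) {a b : V} (hab : G.dist a b = 1)
    (z z' t : V) (hz : z ∈ WW G a b) (hz' : z' ∈ WW G a b)
    (IH : ∀ y ∈ WW G a b, ∀ y' ∈ WW G a b, G.dist y y' < G.dist z z' → itv G y y' ⊆ WW G a b)
    (ht : t ∈ itv G z z') (htW : t ∉ WW G a b) :
    ∃ s, s ∉ WW G a b ∧ G.dist z s = 1 ∧ 1 + G.dist s z' = G.dist z z' ∧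
      G.dist s a = G.dist s z' + G.dist z' a ∧ G.dist s a = G.dist z a + 1 ∧
      G.dist s b = G.dist z a := by
  have hc := hG.1
  have hne : z ≠ t := by rintro rfl; exact htW hz
  obtain ⟨s, hs1, hs2⟩ := exists_next hc hne
  simp only [itv, Set.mem_ofPred_eq] at ht
  have e1 := hc.dist_triangle (u := z) (v := s) (w := z')
  have e2 := hc.dist_triangle (u := s) (v := t) (w := z')
  have hsz : 1 + G.dist s z' = G.dist z z' := by omega
  have hsW : s ∉ WW G a b := by
    intro hs
    refine htW (IH s hs z' hz' (by omega) ?_)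
    simp only [itv, Set.mem_ofPred_eq]; omega
  have hsb : G.dist s a = G.dist s b + 1 :=
    (edge_dich hG hab s).resolve_left hsW
  have hza : G.dist z b = G.dist z a + 1 := hz
  have hza' : G.dist z' b = G.dist z' a + 1 := hz'
  have f1 := hc.dist_triangle (u := z) (v := s) (w := b)
  have f2 := hc.dist_triangle (u := s) (v := z) (w := a)
  have f3 := G.dist_comm (u := s) (v := z)
  refine ⟨s, hsW, hs1, hsz, ?_, by omega, by omega⟩
  obtain ⟨m, ⟨h1, h2, h3⟩, -⟩ := hG.2 s z' a
  simp only [itv, Set.mem_ofPred_eq] at h1 h2 h3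
  have g1 := hc.dist_triangle (u := z') (v := m) (w := b)
  have hmW : m ∈ WW G a b := by
    rcases edge_dich hG hab m with h | h
    · exact h
    · omega
  have g2 := hc.dist_triangle (u := z) (v := m) (w := z')
  have g3 := hc.dist_triangle (u := z) (v := s) (w := m)
  have hmz : m = z' := by
    rw [← hc.dist_eq_zero_iff]
    by_contra hpos
    refine hsW (IH z hz m hmW (by omega) ?_)
    simp only [itv, Set.mem_ofPred_eq]; omega
  subst hmz
  have := G.dist_comm (u := s) (v := a)
  have := G.dist_comm (u := s) (v := m)
  have := G.dist_comm (u := m) (v := a)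
  omega

theorem WW_cvx {G : SimpleGraph V} (hG : IsMedianGraph G) {a b : V} (hab : G.dist a b = 1) :
    Cvx G (WW G a b) := by
  have hc := hG.1
  suffices H : ∀ D : ℕ, ∀ z ∈ WW G a b, ∀ z' ∈ WW G a b, G.dist z z' = D →
      itv G z z' ⊆ WW G a b from fun z hz z' hz' => H _ z hz z' hz' rfl
  intro D
  induction D using Nat.strong_induction_on with
  | _ D ih =>
  intro z hz z' hz' hD t ht
  by_contra htW
  have hcm := G.dist_comm (u := z) (v := z')
  obtain ⟨s, hsW, s1, s2, s3, s4, s5⟩ := WW_step hG hab z z' t hz hz'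
    (fun y hy y' hy' hlt => ih _ (by omega) y hy y' hy' rfl) ht htW
  have ht' : t ∈ itv G z' z := by
    simp only [itv, Set.mem_ofPred_eq] at ht ⊢
    have := G.dist_comm (u := z) (v := t)
    have := G.dist_comm (u := z') (v := t)
    omega
  obtain ⟨r, hrW, r1, r2, r3, r4, r5⟩ := WW_step hG hab z' z t hz' hz
    (fun y hy y' hy' hlt => ih _ (by omega) y hy y' hy' rfl) ht' htW
  have hD2 : D = 2 := by omega
  have hza : G.dist z b = G.dist z a + 1 := hz
  have hza' : G.dist z' b = G.dist z' a + 1 := hz'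
  obtain ⟨m, ⟨h1, h2, h3⟩, -⟩ := hG.2 z z' a
  simp only [itv, Set.mem_ofPred_eq] at h1 h2 h3
  have c1 := G.dist_comm (u := a) (v := m)
  have c2 := G.dist_comm (u := a) (v := z)
  have c3 := G.dist_comm (u := m) (v := z)
  have c4 := G.dist_comm (u := m) (v := z')
  have c5 := G.dist_comm (u := s) (v := z)
  have c6 := G.dist_comm (u := s) (v := z')
  have c7 := G.dist_comm (u := b) (v := z)
  have c8 := G.dist_comm (u := b) (v := m)
  have c9 := G.dist_comm (u := b) (v := s)
  have t1 := hc.dist_triangle (u := m) (v := a) (w := b)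
  have t2 := hc.dist_triangle (u := z) (v := m) (w := b)
  obtain ⟨q, -, hq⟩ := hG.2 z z' b
  have hm : m = q := hq m (by simp only [itv, Set.mem_ofPred_eq]; omega)
  have hs : s = q := hq s (by simp only [itv, Set.mem_ofPred_eq]; omega)
  have : m = s := hm.trans hs.symm
  subst this
  omega

theorem WW_compl {G : SimpleGraph V} (hG : IsMedianGraph G) {a b : V} (hab : G.dist a b = 1) :
    (WW G a b)ᶜ = WW G b a := by
  ext z
  have := edge_dich hG hab z
  simp only [WW, Set.mem_compl_iff, Set.mem_ofPred_eq]
  omega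

theorem exists_sep {G : SimpleGraph V} (hG : IsMedianGraph G) {w w' : V} (hne : w ≠ w') :
    ∃ k, IsHalfspace G k ∧ w ∈ k ∧ w' ∉ k := by
  have hc := hG.1
  obtain ⟨u, hu1, hu2⟩ := exists_next hc hne
  have hu1' : G.dist u w = 1 := by rw [G.dist_comm]; exact hu1
  have hw : w ∈ WW G w u := by simp [WW, hu1]
  have hw' : w' ∉ WW G w u := by
    simp only [WW, Set.mem_ofPred_eq]
    have := G.dist_comm (u := w) (v := w')
    have := G.dist_comm (u := u) (v := w')
    omega
  refine ⟨WW G w u, ⟨⟨w, hw⟩, ⟨w', hw'⟩, WW_cvx hG hu1, ?_⟩, hw, hw'⟩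
  rw [WW_compl hG hu1]
  exact WW_cvx hG hu1'

theorem halfspace_edge {G : SimpleGraph V} (hG : IsMedianGraph G) {a b : V}
    (hab : G.dist a b = 1) {h : Set V} (hh : h ∈ Hset G a b) : h = WW G a b := by
  obtain ⟨⟨-, -, h1, h2⟩, ha, hb⟩ := hh
  have hba : G.dist b a = 1 := by rw [G.dist_comm]; exact hab
  ext z
  constructor
  · intro hz
    refine (edge_dich hG hab z).resolve_right fun h => hb (h1 z hz a ha ?_)
    simp only [itv, Set.mem_ofPred_eq]; omega
  · intro hz
    by_contra hz'
    refine h2 z hz' b hb (?_ : a ∈ itv G z b) ha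
    simp only [itv, WW, Set.mem_ofPred_eq] at hz ⊢; omega

theorem Hset_finite {G : SimpleGraph V} (hG : IsMedianGraph G) (x y : V) :
    (Hset G x y).Finite := by
  obtain ⟨p⟩ := hG.1.preconnected x y
  induction p with
  | nil =>
    refine Set.finite_empty.subset ?_
    rintro h ⟨-, h1, h2⟩
    exact h2 h1
  | @cons u v w hadj p ih =>
    refine ((Set.finite_singleton (WW G u v)).union ih).subset ?_
    rintro h ⟨h0, h1, h2⟩
    by_cases hv : v ∈ h
    · exact Or.inr ⟨h0, hv, h2⟩
    · exact Or.inl (halfspace_edge hG (SimpleGraph.dist_eq_one_iff_adj.2 hadj) ⟨h0, h1, hv⟩)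

theorem le_dnor {G : SimpleGraph V} (hG : IsMedianGraph G) (x y : V) (c : Set (Set V))
    (hc : c ⊆ Hset G x y) (hch : IsChain (· ⊆ ·) c) (m : ℕ) (hm : c.encard = m) :
    m ≤ dnor G x y := by
  refine le_csSup ⟨(Hset G x y).ncard, ?_⟩ ⟨c, hc, hch, hm⟩
  rintro k ⟨d, hd, -, hk⟩
  have h1 := Set.encard_le_encard hd
  rw [hk, ← (Hset_finite hG x y).cast_ncard_eq] at h1
  exact_mod_cast h1

/-- The chain of length `n` below `h` ending with any larger halfspace bounds `dnor`. -/
theorem dnor_gt {G : SimpleGraph V} (hG : IsMedianGraph G) {x₀ x : V} {n : ℕ} (hn : 1 ≤ n)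
    {h : Set V} (hh : h ∈ Hn G x₀ x n) {k : Set V} {w : V} (hk : k ∈ Hset G x₀ w)
    (hw : w ∉ h) (hsub : h ⊆ k) (hne : ¬ k ⊆ h) : n + 1 ≤ dnor G x₀ w := by
  obtain ⟨-, hS⟩ := hh
  have hmem : n ∈ {m : ℕ | ∃ c : Set (Set V), c ⊆ {k | k ∈ Hset G x₀ x ∧ k ⊆ h} ∧
      IsChain (· ⊆ ·) c ∧ c.encard = m} := by
    have hne' : {m : ℕ | ∃ c : Set (Set V), c ⊆ {k | k ∈ Hset G x₀ x ∧ k ⊆ h} ∧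
        IsChain (· ⊆ ·) c ∧ c.encard = m}.Nonempty :=
      ⟨0, ∅, Set.empty_subset _, IsChain.empty, by simp⟩
    conv => arg 2; rw [← hS]
    apply Nat.sSup_mem hne'
    by_contra hb
    have := Nat.sSup_of_not_bddAbove hb
    omega
  obtain ⟨c, hc, hch, hcn⟩ := hmem
  refine le_dnor hG x₀ w (insert k c) ?_ ?_ _ ?_
  · intro j hj
    rcases hj with rfl | hj
    · exact hk
    · exact ⟨(hc hj).1.1, (hc hj).1.2.1, fun h' => hw ((hc hj).2 h')⟩
  · exact hch.insert fun j hj _ => Or.inr ((hc hj).2.trans hsub)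
  · rw [Set.encard_insert_of_notMem (fun hkc => hne (hc hkc).2), hcn]
    push_cast; rfl

theorem gate {G : SimpleGraph V} (hG : IsMedianGraph G) {S : Set V} (hS : Cvx G S) (x₀ p : V)
    (hp : p ∈ S) (hmin : ∀ q ∈ S, G.dist x₀ p ≤ G.dist x₀ q) (q : V) (hq : q ∈ S) :
    p ∈ itv G x₀ q := by
  obtain ⟨m, ⟨h1, h2, h3⟩, -⟩ := hG.2 x₀ p q
  have hm := hmin m (hS p hp q hq h2)
  have h1' := h1
  simp only [itv, Set.mem_ofPred_eq] at h1'
  have h0 : G.dist m p = 0 := by omega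
  rw [hG.1.dist_eq_zero_iff] at h0
  subst h0
  simp only [itv, Set.mem_ofPred_eq] at h3 ⊢
  have := G.dist_comm (u := x₀) (v := m)
  have := G.dist_comm (u := x₀) (v := q)
  have := G.dist_comm (u := m) (v := q)
  omega

theorem IsHalfspace.compl {G : SimpleGraph V} {k : Set V} (hk : IsHalfspace G k) :
    IsHalfspace G kᶜ := by
  obtain ⟨a, b, c, d⟩ := hk
  exact ⟨b, by rwa [compl_compl], d, by rwa [compl_compl]⟩

theorem uniq {G : SimpleGraph V} (hG : IsMedianGraph G) {x₀ x : V} {n : ℕ} (hn : 1 ≤ n)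
    {h : Set V} (hh : h ∈ Hn G x₀ x n) {w w' : V}
    (hw : dnor G x₀ w ≤ n ∧ w ∉ h ∧
      ∀ k : Set V, IsHalfspace G k → Crosses k h → (w ∈ k ↔ x₀ ∈ k))
    (hw' : dnor G x₀ w' ≤ n ∧ w' ∉ h ∧
      ∀ k : Set V, IsHalfspace G k → Crosses k h → (w' ∈ k ↔ x₀ ∈ k)) : w = w' := by
  have key : ∀ w w' : V, (w ∉ h ∧
        ∀ k : Set V, IsHalfspace G k → Crosses k h → (w ∈ k ↔ x₀ ∈ k)) →
      (dnor G x₀ w' ≤ n ∧ w' ∉ h ∧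
        ∀ k : Set V, IsHalfspace G k → Crosses k h → (w' ∈ k ↔ x₀ ∈ k)) →
      ∀ k, IsHalfspace G k → x₀ ∈ k → w ∈ k → w' ∉ k → False := by
    rintro w w' ⟨a2, a3⟩ ⟨b1, b2, b3⟩ k hk h0 hwk hwk'
    have hx0 : x₀ ∈ h := hh.1.2.1
    by_cases hcr : Crosses k h
    · exact hwk' ((b3 k hk hcr).2 h0)
    · have hsub : h ⊆ k := by
        intro z hz
        by_contra hzk
        exact hcr ⟨⟨x₀, h0, hx0⟩, ⟨w, hwk, a2⟩, ⟨z, hzk, hz⟩, ⟨w', hwk', b2⟩⟩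
      have := dnor_gt hG hn hh (k := k) (w := w') ⟨hk, h0, hwk'⟩ b2 hsub (fun hs => a2 (hs hwk))
      omega
  by_contra hne
  obtain ⟨k, hk, h1, h2⟩ := exists_sep hG hne
  by_cases h0 : x₀ ∈ k
  · exact key w w' hw.2 hw' k hk h0 h1 h2
  · exact key w' w hw'.2 hw kᶜ hk.compl h0 h2 (fun hcc => hcc h1)

theorem xh_good {G : SimpleGraph V} (hG : IsMedianGraph G)
    (x₀ x : V) (n : ℕ) (h : Set V) (hh : h ∈ Hn G x₀ x n)
    (xh : V) (hxh : xh ∈ Fh G x₀ x n h)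
    (hmin : ∀ w ∈ Fh G x₀ x n h, G.dist x₀ xh ≤ G.dist x₀ w) :
    ∀ k : Set V, IsHalfspace G k → Crosses k h → (xh ∈ k ↔ x₀ ∈ k) := by
  have hS : Cvx G hᶜ := hh.1.1.2.2.2
  have hx0 : x₀ ∈ h := hh.1.2.1
  obtain ⟨p, hp, hpmin⟩ : ∃ p ∈ hᶜ, ∀ q ∈ hᶜ, G.dist x₀ p ≤ G.dist x₀ q := by
    have hne : hᶜ.Nonempty := ⟨x, hh.1.2.2⟩
    exact ⟨Function.argminOn (G.dist x₀) hᶜ hne, Function.argminOn_mem _ _ hne,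
      fun q hq => Function.argminOn_le _ _ hq⟩
  have hgate := gate hG hS x₀ p hp hpmin
  have hbelow : ∀ k, IsHalfspace G k → x₀ ∈ k → p ∉ k → k ⊆ h := by
    intro k hk h0 hpk z hz
    by_contra hzh
    exact hpk (hk.2.2.1 x₀ h0 z hz (hgate z hzh))
  have hset : {k | k ∈ Hset G x₀ x ∧ k ⊆ h} = Hset G x₀ p := by
    ext k
    constructor
    · rintro ⟨⟨a, b, c⟩, d⟩
      exact ⟨a, b, fun hpk => hp (d hpk)⟩
    · rintro ⟨a, b, c⟩
      have hs := hbelow k a b c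
      exact ⟨⟨a, b, fun hxk => hh.1.2.2 (hs hxk)⟩, hs⟩
  have hpF : p ∈ Fh G x₀ x n h := by
    refine ⟨hgate x hh.1.2.2, ?_, hp⟩
    have h2 := hh.2
    rw [hset] at h2
    exact h2
  have heq : p = xh := by
    have h1 := hmin p hpF
    have h2 := hgate xh hxh.2.2
    simp only [itv, Set.mem_ofPred_eq] at h2
    rw [← hG.1.dist_eq_zero_iff]
    omega
  subst heq
  intro k hk hcr
  obtain ⟨c1, c2, c3, c4⟩ := hcr
  constructor
  · intro hpk
    by_contra h0
    obtain ⟨z, hz, hz'⟩ := c4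
    exact hz' (hbelow kᶜ hk.compl h0 (fun hcc => hcc hpk) hz)
  · intro h0
    by_contra hpk
    obtain ⟨z, hz, hz'⟩ := c2
    exact hz' (hbelow k hk h0 hpk hz)

end MedianGraph

/-- In a median graph, fix `x₀, x` and an integer `n ≥ 1` with
`d_nor(x₀,x) ≥ n`; let `h ∈ H_n`, `F_h` nonempty, and `x_h ∈ F_h` minimizing `d(x₀,·)`
over `F_h`. Then `x_h` is the unique point `w ∈ B_nor(x₀,n)` with `w ∉ h` such that no
halfspace crossing `h` separates `w` from `x₀`. -/
theorem xh_characterization {V : Type*} (G : SimpleGraph V) (hG : IsMedianGraph G)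
    (x₀ x : V) (n : ℕ) (hn : 1 ≤ n) (hd : n ≤ dnor G x₀ x)
    (h : Set V) (hh : h ∈ Hn G x₀ x n)
    (xh : V) (hxh : xh ∈ Fh G x₀ x n h)
    (hmin : ∀ w ∈ Fh G x₀ x n h, G.dist x₀ xh ≤ G.dist x₀ w) :
    (dnor G x₀ xh ≤ n ∧ xh ∉ h ∧
      ∀ k : Set V, IsHalfspace G k → Crosses k h → (xh ∈ k ↔ x₀ ∈ k)) ∧
    ∀ w : V, (dnor G x₀ w ≤ n ∧ w ∉ h ∧
      ∀ k : Set V, IsHalfspace G k → Crosses k h → (w ∈ k ↔ x₀ ∈ k)) → w = xh := by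
  have hg := xh_good hG x₀ x n h hh xh hxh hmin
  have hx : dnor G x₀ xh ≤ n ∧ xh ∉ h ∧
      ∀ k : Set V, IsHalfspace G k → Crosses k h → (xh ∈ k ↔ x₀ ∈ k) :=
    ⟨hxh.2.1.le, hxh.2.2, hg⟩
  exact ⟨hx, fun w hw => uniq hG hn hh hw hx⟩
end

section
/- Let V be the vertex set of a median graph of dimension at most η, for some η ∈ ℕ, equipped with the edge-path metric d. Then (V,d) has finite asymptotic dimension: there exists n ∈ ℕ with asdim(V,d) ≤ n. (In particular, every CAT(0) cube complex of finite dimension has finite asymptotic dimension, since by Chepoi's theorem the vertex set of a finite-dimensional CAT(0) cube complex with its edge-path metric is a median graph of finite dimension, and this vertex set is coarsely equivalent to the complex.) -/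
open scoped ENNReal

open MedianGraph

/-- `AsdimLE d n`: the space with distance function `d` has asymptotic dimension at most
`n`; for every `r > 0` there are `n+1` families of subsets, jointly covering, each family
`r`-disjoint, with all members of all families of diameter bounded by a common constant. -/
def AsdimLE {X : Type*} (d : X → X → ℝ) (n : ℕ) : Prop :=
  ∀ r : ℝ, 0 < r →
    ∃ (F : Fin (n + 1) → Set (Set X)) (R : ℝ),
      (∀ x : X, ∃ i : Fin (n + 1), ∃ u ∈ F i, x ∈ u) ∧
      (∀ i : Fin (n + 1), ∀ u ∈ F i, ∀ v ∈ F i, u ≠ v →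
        ∀ a ∈ u, ∀ b ∈ v, r ≤ d a b) ∧
      (∀ i : Fin (n + 1), ∀ u ∈ F i, ∀ a ∈ u, ∀ b ∈ u, d a b ≤ R)

namespace MedianGraph

/-- Members of the family `H` containing `x` and not `y`. -/
def sep {V : Type*} (H : Set (Set V)) (x y : V) : Set (Set V) :=
  {h | h ∈ H ∧ x ∈ h ∧ y ∉ h}

/-- Number of separating walls. -/
noncomputable def wd {V : Type*} (H : Set (Set V)) (x y : V) : ℕ := (sep H x y).ncard

/-- Wall spaces of dimension at most `η`. -/
structure WS {V : Type*} (H : Set (Set V)) (η : ℕ) : Prop where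
  compl : ∀ h ∈ H, hᶜ ∈ H
  fin : ∀ x y, (sep H x y).Finite
  dim : ∀ F : Set (Set V), F ⊆ H → (∀ h ∈ F, ∀ k ∈ F, h ≠ k → Crosses h k) → F.encard ≤ η

/-- There is a chain of length `n + 1` of members of `H` containing `o`, with top element `h`. -/
def ch {V : Type*} (H : Set (Set V)) (o : V) : ℕ → Set V → Prop
  | 0, h => h ∈ H ∧ o ∈ h
  | n + 1, h => (h ∈ H ∧ o ∈ h) ∧ ∃ k, ch H o n k ∧ k ⊂ h

section wall
variable {V : Type*} {H : Set (Set V)} {η : ℕ}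

lemma wd_self (x : V) : wd H x x = 0 := by
  have : sep H x x = ∅ := by
    ext h; simp [sep]
  simp [wd, this]

lemma wd_tri (hW : WS H η) (x y z : V) : wd H x z ≤ wd H x y + wd H y z := by
  have : sep H x z ⊆ sep H x y ∪ sep H y z := by
    rintro h ⟨h1, h2, h3⟩
    by_cases hy : y ∈ h
    · exact Or.inr ⟨h1, hy, h3⟩
    · exact Or.inl ⟨h1, h2, hy⟩
  exact (Set.ncard_le_ncard this ((hW.fin x y).union (hW.fin y z))).trans
    (Set.ncard_union_le _ _)

lemma wd_le_symm (hW : WS H η) (x y : V) : wd H x y ≤ wd H y x := by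
  refine Set.ncard_le_ncard_of_injOn (fun h => hᶜ) ?_ ?_ (hW.fin y x)
  · rintro h ⟨h1, h2, h3⟩
    exact ⟨hW.compl h h1, h3, fun h4 => h4 h2⟩
  · intro a _ b _ hab
    exact compl_injective hab

lemma wd_symm (hW : WS H η) (x y : V) : wd H x y = wd H y x :=
  le_antisymm (wd_le_symm hW x y) (wd_le_symm hW y x)

lemma ch_mem {o : V} : ∀ {n : ℕ} {h : Set V}, ch H o n h → h ∈ H ∧ o ∈ h
  | 0, _, hc => hc
  | _ + 1, _, hc => hc.1

lemma ch_pred {o : V} : ∀ {n : ℕ} {h : Set V}, ch H o (n + 1) h → ch H o n h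
  | 0, _, hc => hc.1
  | _ + 1, _, hc => by
    obtain ⟨h1, k, hk, hlt⟩ := hc
    exact ⟨h1, k, ch_pred hk, hlt⟩

lemma ch_mono {o : V} {n m : ℕ} (hnm : n ≤ m) {h : Set V} (hc : ch H o m h) : ch H o n h := by
  induction m, hnm using Nat.le_induction with
  | base => exact hc
  | succ m _ ih => exact ih (ch_pred hc)

/-- Going down a chain. -/
lemma ch_down (hW : WS H η) {o x : V} {n : ℕ} : ∀ (s : ℕ) {h : Set V}, ch H o (n + s) h → x ∉ h →
    ∃ k ⊆ h, ch H o n k ∧ (¬ ch H o (n + s + 1) h → ¬ ch H o (n + 1) k) ∧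
      ∀ z ∈ k, s + 1 ≤ {g | g ∈ sep H z x ∧ g ⊆ h}.ncard := by
  intro s
  induction s with
  | zero =>
    intro h hc hx
    refine ⟨h, subset_rfl, hc, fun h => h, fun z hz => ?_⟩
    have hf : {g | g ∈ sep H z x ∧ g ⊆ h}.Finite := (hW.fin z x).subset (fun g hg => hg.1)
    have : 0 < {g | g ∈ sep H z x ∧ g ⊆ h}.ncard := by
      rw [Set.ncard_pos hf]
      exact ⟨h, ⟨(ch_mem hc).1, hz, hx⟩, subset_rfl⟩
    omega
  | succ s ih =>
    intro h hc hx
    obtain ⟨h1, k', hk', hlt⟩ := (hc : ch H o ((n + s) + 1) h)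
    obtain ⟨k, hkk, hk, hn, hz⟩ := ih hk' (fun hh => hx (hlt.1 hh))
    refine ⟨k, hkk.trans hlt.1, hk, fun hno => hn (fun hh => hno ⟨h1, k', hh, hlt⟩), ?_⟩
    intro z hzk
    have hf : {g | g ∈ sep H z x ∧ g ⊆ h}.Finite := (hW.fin z x).subset (fun g hg => hg.1)
    have h2 : {g | g ∈ sep H z x ∧ g ⊆ k'} ⊂ {g | g ∈ sep H z x ∧ g ⊆ h} := by
      refine ⟨fun g hg => ⟨hg.1, hg.2.trans hlt.1⟩, fun hsub => ?_⟩
      have := hsub (show h ∈ _ from ⟨⟨h1.1, hlt.1 (hkk hzk), hx⟩, subset_rfl⟩)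
      exact hlt.2 this.2
    have := Set.ncard_lt_ncard h2 hf
    have := hz z hzk
    omega

lemma ch_down' (hW : WS H η) {o x : V} {n : ℕ} (s : ℕ) {h : Set V} (hc : ch H o (n + s) h)
    (hx : x ∉ h) :
    ∃ k ⊆ h, ch H o n k ∧ (¬ ch H o (n + s + 1) h → ¬ ch H o (n + 1) k) ∧
      ∀ z ∈ k, s + 1 ≤ wd H z x := by
  obtain ⟨k, h1, h2, h3, h4⟩ := ch_down hW s hc hx
  refine ⟨k, h1, h2, h3, fun z hz => (h4 z hz).trans ?_⟩
  exact Set.ncard_le_ncard (fun g hg => hg.1) (hW.fin z x)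

lemma exists_not (hW : WS H η) (o x : V) : ∃ n, ∀ h, x ∉ h → ¬ ch H o n h := by
  refine ⟨wd H o x, fun h hx hc => ?_⟩
  obtain ⟨k, _, hk, _, hz⟩ := ch_down' hW (n := 0) (wd H o x) (by simpa using hc) hx
  have := hz o (ch_mem hk).2
  omega

open Classical in
/-- The normal distance from `o`. -/
noncomputable def nd (hW : WS H η) (o x : V) : ℕ := Nat.find (exists_not hW o x)

lemma nd_spec (hW : WS H η) {o x : V} {h : Set V} (hx : x ∉ h) : ¬ ch H o (nd hW o x) h := by
  classical
  exact Nat.find_spec (exists_not hW o x) h hx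

lemma nd_lt (hW : WS H η) {o x : V} {n : ℕ} (hn : n < nd hW o x) : ∃ h, x ∉ h ∧ ch H o n h := by
  classical
  have := Nat.find_min (exists_not hW o x) hn
  push Not at this
  exact this

lemma nd_lip (hW : WS H η) (o x y : V) : nd hW o x ≤ nd hW o y + wd H y x := by
  by_contra hlt
  push Not at hlt
  obtain ⟨h, hx, hc⟩ := nd_lt hW hlt
  obtain ⟨k, _, hk, _, hz⟩ := ch_down' hW (wd H y x) hc hx
  by_cases hy : y ∈ k
  · have := hz y hy
    omega
  · exact nd_spec hW hy hk

/-- halfspaces of height exactly `n` not containing `x`. -/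
def lev (H : Set (Set V)) (o x : V) (n : ℕ) : Set (Set V) :=
  {h | x ∉ h ∧ ch H o n h ∧ ¬ ch H o (n + 1) h}

lemma lev_encard (hW : WS H η) (o x : V) (n : ℕ) : (lev H o x n).encard ≤ η := by
  refine hW.dim _ (fun h hh => (ch_mem hh.2.1).1) ?_
  have key : ∀ h ∈ lev H o x n, ∀ k ∈ lev H o x n, h ≠ k → (h ∩ kᶜ).Nonempty := by
    intro h hh k hk hne
    by_contra hcon
    rw [Set.not_nonempty_iff_eq_empty, ← Set.sdiff_eq, Set.sdiff_eq_empty] at hcon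
    exact hk.2.2 ⟨ch_mem hk.2.1, h, hh.2.1, hcon.ssubset_of_ne hne⟩
  intro h hh k hk hne
  refine ⟨⟨o, (ch_mem hh.2.1).2, (ch_mem hk.2.1).2⟩, key h hh k hk hne, ?_, ⟨x, hh.1, hk.1⟩⟩
  rw [Set.inter_comm]
  exact key k hk h hh hne.symm

lemma lev_fin (hW : WS H η) (o x : V) (n : ℕ) : (lev H o x n).Finite :=
  Set.finite_of_encard_le_coe (lev_encard hW o x n)

lemma lev_ncard (hW : WS H η) (o x : V) (n : ℕ) : (lev H o x n).ncard ≤ η := by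
  have := lev_encard hW o x n
  rw [← (lev_fin hW o x n).cast_ncard_eq] at this
  exact_mod_cast this

lemma upper_ncard (hW : WS H η) (o x : V) (a : ℕ) :
    {k | x ∉ k ∧ ch H o a k}.ncard ≤ (nd hW o x - a) * η := by
  have key : ∀ s a, nd hW o x ≤ a + s → {k | x ∉ k ∧ ch H o a k}.ncard ≤ s * η := by
    intro s
    induction s with
    | zero =>
      intro a ha
      have : {k | x ∉ k ∧ ch H o a k} = ∅ := by
        ext k
        simp only [Set.mem_ofPred_eq, Set.mem_empty_iff_false, iff_false]
        rintro ⟨h1, h2⟩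
        exact nd_spec hW h1 (ch_mono ha h2)
      simp [this]
    | succ s ih =>
      intro a ha
      have h1 : {k | x ∉ k ∧ ch H o a k} ⊆ lev H o x a ∪ {k | x ∉ k ∧ ch H o (a + 1) k} := by
        rintro k ⟨h1, h2⟩
        by_cases h3 : ch H o (a + 1) k
        · exact Or.inr ⟨h1, h3⟩
        · exact Or.inl ⟨h1, h2, h3⟩
      have hf : {k | x ∉ k ∧ ch H o (a + 1) k}.Finite :=
        (hW.fin o x).subset fun k hk => ⟨(ch_mem hk.2).1, (ch_mem hk.2).2, hk.1⟩
      have h2 := Set.ncard_le_ncard h1 ((lev_fin hW o x a).union hf)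
      have h3 := Set.ncard_union_le (lev H o x a) {k | x ∉ k ∧ ch H o (a + 1) k}
      have h4 := lev_ncard hW o x a
      have h5 := ih (a + 1) (by omega)
      rw [add_mul]
      omega
  exact key _ a (by omega)

lemma wd_le_nd (hW : WS H η) (o x : V) : wd H o x ≤ nd hW o x * η := by
  have := upper_ncard hW o x 0
  have h2 : sep H o x = {k | x ∉ k ∧ ch H o 0 k} := by
    ext k; simp only [sep, ch, Set.mem_ofPred_eq]; tauto
  rw [wd, h2]; simpa using this

/-- Members of `H` crossing `h`. -/
def sub (H : Set (Set V)) (h : Set V) : Set (Set V) := {k | k ∈ H ∧ Crosses h k}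

lemma sub_WS (hW : WS H (η + 1)) {h : Set V} (hh : h ∈ H) : WS (sub H h) η := by
  constructor
  · rintro k ⟨hk, h1, h2, h3, h4⟩
    exact ⟨hW.compl k hk, h2, by rwa [compl_compl], h4, by rwa [compl_compl]⟩
  · intro x y
    exact (hW.fin x y).subset fun k hk => ⟨hk.1.1, hk.2⟩
  · intro F hF hcr
    have hnot : h ∉ F := by
      intro hhF
      obtain ⟨z, hz, hz'⟩ := (hF hhF).2.2.1
      exact hz' hz
    have hsym : ∀ k, Crosses h k → Crosses k h := by
      rintro k ⟨h1, h2, h3, h4⟩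
      exact ⟨by rwa [Set.inter_comm], by rwa [Set.inter_comm], by rwa [Set.inter_comm],
        by rwa [Set.inter_comm]⟩
    have := hW.dim (insert h F) (by
      rintro k (rfl | hk)
      · exact hh
      · exact (hF hk).1) (by
      rintro k (rfl | hk) l (rfl | hl) hne
      · exact absurd rfl hne
      · exact (hF hl).2
      · exact hsym _ (hF hk).2
      · exact hcr k hk l hl hne)
    rw [Set.encard_insert_of_notMem hnot] at this
    push_cast at this
    exact (ENat.add_le_add_iff_right ENat.one_ne_top).1 this

lemma wd_sub_le (hW : WS H η) (h : Set V) (x y : V) : wd (sub H h) x y ≤ wd H x y :=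
  Set.ncard_le_ncard (fun k hk => ⟨hk.1.1, hk.2⟩) (hW.fin x y)

lemma wd_le_sub (hW : WS H η) {o x y : V} {n C : ℕ} {h : Set V} (hx : x ∉ h) (hy : y ∉ h)
    (hc : ch H o n h) (hxC : (nd hW o x - n) * η ≤ C) (hyC : (nd hW o y - n) * η ≤ C) :
    wd H x y ≤ wd (sub H h) x y + 2 * C := by
  have ho := (ch_mem hc).2
  have up : ∀ k ∈ H, h ⊆ k → ch H o n k := by
    intro k hk hhk
    by_cases he : h = k
    · exact he ▸ hc
    · exact ch_pred ⟨⟨hk, hhk ho⟩, h, hc, hhk.ssubset_of_ne he⟩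
  set A : Set (Set V) := {k | y ∉ k ∧ ch H o n k} with hA
  set B : Set (Set V) := {k | x ∉ k ∧ ch H o n k} with hB
  have hAf : A.Finite :=
    (hW.fin o y).subset fun k hk => ⟨(ch_mem hk.2).1, (ch_mem hk.2).2, hk.1⟩
  have hBf : B.Finite :=
    (hW.fin o x).subset fun k hk => ⟨(ch_mem hk.2).1, (ch_mem hk.2).2, hk.1⟩
  have hsub : sep H x y ⊆ sep (sub H h) x y ∪ (A ∪ Set.image compl B) := by
    rintro k ⟨hk, hxk, hyk⟩
    by_cases h1 : h ⊆ k
    · exact Or.inr (Or.inl ⟨hyk, up k hk h1⟩)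
    by_cases h2 : h ⊆ kᶜ
    · exact Or.inr (Or.inr ⟨kᶜ, ⟨fun h => h hxk, up _ (hW.compl k hk) h2⟩, compl_compl k⟩)
    refine Or.inl ⟨⟨hk, ?_, ?_, ⟨x, hx, hxk⟩, ⟨y, hy, hyk⟩⟩, hxk, hyk⟩
    · obtain ⟨z, hz, hz'⟩ := Set.not_subset.1 h2
      exact ⟨z, hz, not_not.1 hz'⟩
    · obtain ⟨z, hz, hz'⟩ := Set.not_subset.1 h1
      exact ⟨z, hz, hz'⟩
  have hsf : (sep (sub H h) x y).Finite := (hW.fin x y).subset fun k hk => ⟨hk.1.1, hk.2⟩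
  have e1 := Set.ncard_le_ncard hsub (hsf.union (hAf.union (hBf.image _)))
  have e2 := Set.ncard_union_le (sep (sub H h) x y) (A ∪ Set.image compl B)
  have e3 := Set.ncard_union_le A (Set.image compl B)
  have e4 := Set.ncard_image_le (f := compl) hBf
  have e5 : A.ncard ≤ C := (upper_ncard hW o y n).trans hyC
  have e6 : B.ncard ≤ C := (upper_ncard hW o x n).trans hxC
  unfold wd
  omega

/-- Halfspaces of height `n`, at distance more than `m` from `x`. -/
def Es (H : Set (Set V)) (o : V) (n m : ℕ) (x : V) : Set (Set V) :=
  {h | ch H o n h ∧ ¬ ch H o (n + 1) h ∧ ∀ z ∈ h, m < wd H z x}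

lemma Es_sub_lev {o x : V} {n m : ℕ} : Es H o n m x ⊆ lev H o x n := by
  rintro h ⟨h1, h2, h3⟩
  refine ⟨fun hx => ?_, h1, h2⟩
  have := h3 x hx
  rw [wd_self] at this
  omega

lemma Es_anti {o x : V} {n m m' : ℕ} (h : m ≤ m') : Es H o n m' x ⊆ Es H o n m x :=
  fun _ hk => ⟨hk.1, hk.2.1, fun z hz => h.trans_lt (hk.2.2 z hz)⟩

lemma Es_move (hW : WS H η) {o x y : V} {n m r : ℕ} (hxy : wd H y x ≤ r) :
    Es H o n (m + r) x ⊆ Es H o n m y := by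
  rintro h ⟨h1, h2, h3⟩
  refine ⟨h1, h2, fun z hz => ?_⟩
  have := h3 z hz
  have := wd_tri hW z y x
  omega

lemma Es_nonempty (hW : WS H η) {o x : V} {n m : ℕ} (h : n + m + 1 ≤ nd hW o x) :
    (Es H o n m x).Nonempty := by
  obtain ⟨s, hs⟩ : ∃ s, nd hW o x = n + s + 1 := ⟨nd hW o x - n - 1, by omega⟩
  obtain ⟨h, hx, hc⟩ := nd_lt hW (show n + s < nd hW o x by omega)
  obtain ⟨k, _, h1, h2, h3⟩ := ch_down' hW s hc hx
  refine ⟨k, h1, h2 ?_, fun z hz => ?_⟩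
  · rw [← hs]; exact nd_spec hW hx
  · have := h3 z hz
    omega

lemma Es_stab (hW : WS H η) (o x : V) (n r : ℕ) :
    ∃ j : Fin (η + 1), Es H o n (j * r) x = Es H o n ((j + 1) * r) x := by
  by_contra hcon
  push Not at hcon
  have key : ∀ j ≤ η + 1, (Es H o n (j * r) x).ncard + j ≤ η := by
    intro j hj
    induction j with
    | zero =>
      exact (Set.ncard_le_ncard Es_sub_lev (lev_fin hW o x n)).trans (lev_ncard hW o x n)
    | succ j ih =>
      have h1 := ih (by omega)
      have h2 : Es H o n ((j + 1) * r) x ⊂ Es H o n (j * r) x :=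
        (Es_anti (by gcongr; omega)).ssubset_of_ne (hcon ⟨j, by omega⟩).symm
      have := Set.ncard_lt_ncard h2 ((lev_fin hW o x n).subset Es_sub_lev)
      omega
  have := key (η + 1) le_rfl
  omega

end wall

/-- The relation: same colour and at distance at most `r`. -/
def step {V K : Type*} (H : Set (Set V)) (r : ℕ) (c : V → K) (a b : V) : Prop :=
  c a = c b ∧ wd H a b ≤ r

theorem wall_main {V : Type*} (η : ℕ) : ∃ N : ℕ, ∀ r : ℕ, ∃ R : ℕ, ∀ H : Set (Set V), WS H η →
    ∃ c : V → Fin N, ∀ x y, Relation.ReflTransGen (step H r c) x y → wd H x y ≤ R := by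
  classical
  induction η with
  | zero =>
    refine ⟨1, fun r => ⟨0, fun H hW => ⟨fun _ => 0, fun x y _ => ?_⟩⟩⟩
    have : sep H x y = ∅ := by
      rw [Set.eq_empty_iff_forall_notMem]
      intro h hh
      have := hW.dim {h} (by simpa using hh.1) (by
        rintro a rfl b rfl hne
        exact absurd rfl hne)
      simp at this
    simp [wd, this]
  | succ η ih =>
    obtain ⟨N, hN⟩ := ih
    refine ⟨Nat.card (Fin 2 × Fin (η + 2) × Option (Fin N)), fun r => ?_⟩
    obtain ⟨R, hR⟩ := hN r
    set T := (η + 2) * r with hT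
    set C := (T + r + 2) * (η + 1) with hC
    refine ⟨R + 2 * C, fun H hW => ?_⟩
    rcases isEmpty_or_nonempty V with hV | ⟨⟨o⟩⟩
    · exact ⟨fun x => (hV.false x).elim, fun x => (hV.false x).elim⟩
    -- colourings for the subfamilies
    have hsubc : ∀ h : Set V, ∃ c : V → Option (Fin N), h ∈ H → ∀ x y,
        Relation.ReflTransGen (step (sub H h) r c) x y → wd (sub H h) x y ≤ R := by
      intro h
      by_cases hh : h ∈ H
      · obtain ⟨c, hc⟩ := hR (sub H h) (sub_WS hW hh)
        refine ⟨fun x => some (c x), fun _ x y hxy => hc x y ?_⟩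
        refine Relation.ReflTransGen.mono ?_ _ _ hxy
        rintro a b ⟨h1, h2⟩
        exact ⟨Option.some_injective _ h1, h2⟩
      · exact ⟨fun _ => none, fun h => absurd h hh⟩
    choose cc hcc using hsubc
    let b : V → ℕ := fun x => nd hW o x / (r + 1)
    let n : ℕ → ℕ := fun β => β * (r + 1) - 1 - T
    have hst : ∀ x, ∃ j : Fin (η + 2),
        Es H o (n (b x)) (j * r) x = Es H o (n (b x)) ((j + 1) * r) x :=
      fun x => Es_stab hW o x (n (b x)) r
    choose j hj using hst
    let E : V → Set (Set V) := fun x => Es H o (n (b x)) (j x * r) x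
    let pick : Set (Set V) → Set V := fun S => if hS : S.Nonempty then hS.some else ∅
    let c₀ : V → Fin 2 × Fin (η + 2) × Option (Fin N) := fun x =>
      (⟨b x % 2, Nat.mod_lt _ (by omega)⟩, j x, cc (pick (E x)) x)
    let e := Finite.equivFin (Fin 2 × Fin (η + 2) × Option (Fin N))
    refine ⟨fun x => e (c₀ x), fun x y hxy => ?_⟩
    have hone : ∀ u v, step H r (fun x => e (c₀ x)) u v → b u = b v ∧ E u = E v ∧
        cc (pick (E u)) u = cc (pick (E v)) v := by
      rintro u v ⟨h1, h2⟩
      have h1 : c₀ u = c₀ v := e.injective h1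
      simp only [c₀, Prod.mk.injEq, Fin.mk.injEq] at h1
      obtain ⟨hb, hjj, hcv⟩ := h1
      have h2' : wd H v u ≤ r := by rwa [wd_symm hW]
      have l1 := nd_lip hW o u v
      have l2 := nd_lip hW o v u
      have hbb : b u = b v := by
        have m1 : b u ≤ b v + 1 := by
          simp only [b]
          rw [← Nat.add_div_right _ (by omega)]
          exact Nat.div_le_div_right (by omega)
        have m2 : b v ≤ b u + 1 := by
          simp only [b]
          rw [← Nat.add_div_right _ (by omega)]
          exact Nat.div_le_div_right (by omega)
        omega
      refine ⟨hbb, ?_, hcv⟩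
      have hu := hj u
      have hv := hj v
      rw [hbb, hjj] at hu
      simp only [E]
      rw [hbb, hjj]
      apply subset_antisymm
      · rw [hu, add_mul, one_mul]
        exact Es_move hW h2'
      · rw [hv, add_mul, one_mul]
        exact Es_move hW h2
    have hchain : b x = b y ∧ E x = E y ∧
        Relation.ReflTransGen (step (sub H (pick (E x))) r (cc (pick (E x)))) x y := by
      induction hxy with
      | refl => exact ⟨rfl, rfl, .refl⟩
      | @tail u v _ huv ih =>
        obtain ⟨i1, i2, i3⟩ := ih
        obtain ⟨k1, k2, k3⟩ := hone u v huv
        refine ⟨i1.trans k1, i2.trans k2, i3.tail ⟨?_, ?_⟩⟩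
        · rw [← k2, ← i2] at k3
          exact k3
        · exact (wd_sub_le hW _ _ _).trans huv.2
    obtain ⟨hb, hE, hc⟩ := hchain
    have hbx := Nat.div_add_mod (nd hW o x) (r + 1)
    have hmx := Nat.mod_lt (nd hW o x) (show r + 1 > 0 by omega)
    have hby := Nat.div_add_mod (nd hW o y) (r + 1)
    have hmy := Nat.mod_lt (nd hW o y) (show r + 1 > 0 by omega)
    change (r + 1) * b x + _ = _ at hbx
    change (r + 1) * b y + _ = _ at hby
    rw [← hb] at hby
    rw [mul_comm] at hbx hby
    have hnd : n (b x) = b x * (r + 1) - 1 - T := rfl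
    have hxC : (nd hW o x - n (b x)) * (η + 1) ≤ C := Nat.mul_le_mul_right _ (by omega)
    have hyC : (nd hW o y - n (b x)) * (η + 1) ≤ C := Nat.mul_le_mul_right _ (by omega)
    by_cases hbig : T + 1 ≤ b x * (r + 1)
    · have hne : (E x).Nonempty := by
        refine Es_nonempty hW ?_
        have : (j x : ℕ) * r ≤ T := Nat.mul_le_mul_right _ (by omega)
        omega
      have hp : pick (E x) ∈ E x := by
        simp only [pick, dif_pos hne]
        exact hne.some_mem
      have hpy : pick (E x) ∈ E y := hE ▸ hp
      have h1 := hcc (pick (E x)) (ch_mem hp.1).1 x y hc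
      have h2 := wd_le_sub hW (Es_sub_lev hp).1 (Es_sub_lev hpy).1 hp.1 hxC hyC
      omega
    · have h0 : n (b x) = 0 := by omega
      rw [h0] at hxC hyC
      have h1 := wd_tri hW x o y
      have h2 := wd_le_nd hW o x
      have h3 := wd_le_nd hW o y
      have h4 := wd_symm hW x o
      simp only [Nat.sub_zero] at hxC hyC
      omega

end MedianGraph

namespace MedianGraph

section median
variable {V : Type*} {G : SimpleGraph V}

lemma adj_dichotomy (hG : IsMedianGraph G) {x y : V} (hxy : G.Adj x y) (z : V) :
    G.dist z y = G.dist z x + 1 ∨ G.dist z x = G.dist z y + 1 := by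
  obtain ⟨m, ⟨h1, h2, h3⟩, -⟩ := hG.2 x y z
  have hd : G.dist x y = 1 := SimpleGraph.dist_eq_one_iff_adj.2 hxy
  simp only [itv, Set.mem_ofPred_eq, hd] at h1 h2 h3
  have c1 := G.dist_comm (u := m) (v := z)
  have c2 := G.dist_comm (u := m) (v := y)
  have c3 := G.dist_comm (u := m) (v := x)
  have c4 := G.dist_comm (u := y) (v := z)
  have c5 := G.dist_comm (u := x) (v := z)
  have t1 := hG.1.dist_triangle (u := z) (v := y) (w := x)
  have t2 := hG.1.dist_triangle (u := z) (v := x) (w := y)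
  have c6 := G.dist_comm (u := x) (v := y)
  rcases Nat.eq_zero_or_pos (G.dist x m) with h0 | h0
  · have := hG.1.dist_eq_zero_iff.1 h0
    subst this
    left; omega
  · have : G.dist m y = 0 := by omega
    have := hG.1.dist_eq_zero_iff.1 this
    subst this
    right; omega

/-- The points closer to `x` than to `y`. -/
def Wd (G : SimpleGraph V) (x y : V) : Set V := {z | G.dist z y = G.dist z x + 1}

lemma not_mem_Wd (hG : IsMedianGraph G) {x y : V} (hxy : G.Adj x y) {z : V} :
    z ∉ Wd G x y ↔ G.dist z x = G.dist z y + 1 := by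
  have := adj_dichotomy hG hxy z
  simp only [Wd, Set.mem_ofPred_eq]
  omega

lemma Wd_compl (hG : IsMedianGraph G) {x y : V} (hxy : G.Adj x y) :
    (Wd G x y)ᶜ = Wd G y x := by
  ext z
  rw [Set.mem_compl_iff, not_mem_Wd hG hxy]
  rfl

/-- a first step on a geodesic -/
lemma first_step (hG : IsMedianGraph G) {a c : V} (hac : a ≠ c) :
    ∃ p, G.Adj a p ∧ G.dist a c = G.dist p c + 1 := by
  obtain ⟨w, hw⟩ := hG.1.exists_walk_length_eq_dist a c
  cases w with
  | nil => exact absurd rfl hac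
  | @cons _ p _ h w' =>
    refine ⟨p, h, ?_⟩
    have h1 := SimpleGraph.dist_le w'
    have t := hG.1.dist_triangle (u := a) (v := p) (w := c)
    rw [SimpleGraph.dist_eq_one_iff_adj.2 h] at t
    simp only [SimpleGraph.Walk.length_cons] at hw
    omega

lemma quad (hG : IsMedianGraph G) {z u v w : V} (huv : G.Adj u v) (huw : G.Adj u w)
    (hvw : v ≠ w) (hv : G.dist z v + 1 = G.dist z u) (hw : G.dist z w + 1 = G.dist z u) :
    G.dist v w = 2 ∧ ∃ t, G.Adj v t ∧ G.Adj w t ∧ G.dist z t + 2 = G.dist z u := by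
  have d1 := SimpleGraph.dist_eq_one_iff_adj.2 huv
  have d2 := SimpleGraph.dist_eq_one_iff_adj.2 huw
  have hd : G.dist v w = 2 := by
    have t := hG.1.dist_triangle (u := v) (v := u) (w := w)
    rw [G.dist_comm (u := v) (v := u)] at t
    have n0 : G.dist v w ≠ 0 := fun h => hvw (hG.1.dist_eq_zero_iff.1 h)
    have n1 : G.dist v w ≠ 1 := by
      intro h
      have := adj_dichotomy hG (SimpleGraph.dist_eq_one_iff_adj.1 h) z
      omega
    omega
  refine ⟨hd, ?_⟩
  obtain ⟨t, ⟨h1, h2, h3⟩, -⟩ := hG.2 v w z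
  simp only [itv, Set.mem_ofPred_eq] at h1 h2 h3
  have c1 := G.dist_comm (u := t) (v := z)
  have c2 := G.dist_comm (u := t) (v := w)
  have c3 := G.dist_comm (u := t) (v := v)
  have c4 := G.dist_comm (u := w) (v := z)
  refine ⟨t, SimpleGraph.dist_eq_one_iff_adj.1 ?_, SimpleGraph.dist_eq_one_iff_adj.1 ?_, ?_⟩ <;>
    omega

lemma local_convex (hG : IsMedianGraph G) {x y : V} (hxy : G.Adj x y) {a b c : V}
    (ha : a ∈ Wd G x y) (hb : b ∈ Wd G x y) (hab : G.dist a b = 2) (hca : G.Adj c a)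
    (hcb : G.Adj c b) : c ∈ Wd G x y := by
  by_contra hc
  rw [not_mem_Wd hG hxy] at hc
  simp only [Wd, Set.mem_ofPred_eq] at ha hb
  have xa := adj_dichotomy hG hca x
  have xb := adj_dichotomy hG hcb x
  have ya := adj_dichotomy hG hca y
  have yb := adj_dichotomy hG hcb y
  have c1 := G.dist_comm (u := x) (v := a)
  have c2 := G.dist_comm (u := x) (v := b)
  have c3 := G.dist_comm (u := x) (v := c)
  have c4 := G.dist_comm (u := y) (v := a)
  have c5 := G.dist_comm (u := y) (v := b)
  have c6 := G.dist_comm (u := y) (v := c)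
  have hne : a ≠ b := by rintro rfl; simp at hab
  obtain ⟨-, t, ta, tb, tx⟩ := quad hG (z := x) hca hcb hne (by omega) (by omega)
  have yt1 := adj_dichotomy hG ta y
  have yt2 := adj_dichotomy hG hxy t
  have c7 := G.dist_comm (u := x) (v := t)
  have c8 := G.dist_comm (u := y) (v := t)
  have dca := SimpleGraph.dist_eq_one_iff_adj.2 hca
  have dcb := SimpleGraph.dist_eq_one_iff_adj.2 hcb
  have dta := SimpleGraph.dist_eq_one_iff_adj.2 ta
  have dtb := SimpleGraph.dist_eq_one_iff_adj.2 tb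
  have c9 := G.dist_comm (u := c) (v := a)
  have c10 := G.dist_comm (u := c) (v := b)
  have c11 := G.dist_comm (u := t) (v := a)
  have c12 := G.dist_comm (u := t) (v := b)
  obtain ⟨m, -, hm⟩ := hG.2 a b y
  have e1 := hm c (by simp only [itv, Set.mem_ofPred_eq]; omega)
  have e2 := hm t (by simp only [itv, Set.mem_ofPred_eq]; omega)
  have : c = t := e1.trans e2.symm
  subst this
  omega

set_option maxHeartbeats 2000000 in
lemma Wd_convex (hG : IsMedianGraph G) {x y : V} (hxy : G.Adj x y) : Cvx G (Wd G x y) := by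
  have key : ∀ n, ∀ a ∈ Wd G x y, ∀ b ∈ Wd G x y, G.dist a b = n → itv G a b ⊆ Wd G x y := by
    intro n
    induction n using Nat.strong_induction_on with
    | _ n ih =>
      intro a ha b hb hn c hc
      by_contra hcW
      simp only [itv, Set.mem_ofPred_eq] at hc
      have hac : a ≠ c := by rintro rfl; exact hcW ha
      have hbc : b ≠ c := by rintro rfl; exact hcW hb
      obtain ⟨a', haa, ha'⟩ := first_step hG hac
      obtain ⟨b', hbb, hb'⟩ := first_step hG hbc
      have daa := SimpleGraph.dist_eq_one_iff_adj.2 haa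
      have dbb := SimpleGraph.dist_eq_one_iff_adj.2 hbb
      have s1 := G.dist_comm (u := b) (v := b')
      have s2 := G.dist_comm (u := b) (v := c)
      have s3 := G.dist_comm (u := b') (v := c)
      have s4 := G.dist_comm (u := a) (v := b)
      have t1 := hG.1.dist_triangle (u := a') (v := c) (w := b)
      have t2 := hG.1.dist_triangle (u := a) (v := a') (w := b)
      have t3 := hG.1.dist_triangle (u := a) (v := c) (w := b')
      have t4 := hG.1.dist_triangle (u := a) (v := b') (w := b)
      have t5 := hG.1.dist_triangle (u := a') (v := c) (w := b')
      have na : a' ∉ Wd G x y := by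
        intro h
        exact hcW (ih (n - 1) (by omega) a' h b hb (by omega)
          (by simp only [itv, Set.mem_ofPred_eq]; omega))
      have nb : b' ∉ Wd G x y := by
        intro h
        exact hcW (ih (n - 1) (by omega) a ha b' h (by omega)
          (by simp only [itv, Set.mem_ofPred_eq]; omega))
      rw [not_mem_Wd hG hxy] at na nb
      have ha2 : G.dist a y = G.dist a x + 1 := ha
      have hb2 : G.dist b y = G.dist b x + 1 := hb
      -- the median of a, b, x
      obtain ⟨m, ⟨m1, m2, m3⟩, -⟩ := hG.2 a b x
      simp only [itv, Set.mem_ofPred_eq] at m1 m2 m3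
      have u1 := hG.1.dist_triangle (u := b') (v := a') (w := y)
      have u2 := hG.1.dist_triangle (u := b) (v := b') (w := x)
      have u3 := hG.1.dist_triangle (u := a') (v := a) (w := y)
      have u4 := hG.1.dist_triangle (u := a) (v := a') (w := y)
      have u5 := hG.1.dist_triangle (u := a') (v := a) (w := x)
      have u6 := hG.1.dist_triangle (u := b) (v := b') (w := y)
      have u7 := G.dist_comm (u := b') (v := a')
      have u8 := G.dist_comm (u := a') (v := a)
      have ham : a ≠ m := by
        rintro rfl
        omega
      obtain ⟨p, hp, hpm⟩ := first_step hG ham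
      have dp := SimpleGraph.dist_eq_one_iff_adj.2 hp
      have v1 := hG.1.dist_triangle (u := p) (v := m) (w := b)
      have v2 := hG.1.dist_triangle (u := a) (v := p) (w := b)
      have v3 := hG.1.dist_triangle (u := p) (v := m) (w := x)
      have v4 := hG.1.dist_triangle (u := a) (v := p) (w := x)
      have v5 := hG.1.dist_triangle (u := a) (v := p) (w := y)
      have v6 := G.dist_comm (u := x) (v := m)
      have v7 := G.dist_comm (u := x) (v := a)
      have v8 := G.dist_comm (u := m) (v := a)
      have hpW : p ∈ Wd G x y := by
        have := adj_dichotomy hG hxy p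
        simp only [Wd, Set.mem_ofPred_eq]
        omega
      have hpa : p ≠ a' := by
        rintro rfl
        exact (not_mem_Wd hG hxy).2 na hpW
      have w1 := G.dist_comm (u := p) (v := b)
      have w2 := G.dist_comm (u := a') (v := b)
      obtain ⟨-, t, tp, ta, tb⟩ := quad hG (z := b) hp haa hpa (by omega) (by omega)
      have w3 := G.dist_comm (u := t) (v := b)
      have dtp := SimpleGraph.dist_eq_one_iff_adj.2 tp
      have htW : t ∈ Wd G x y :=
        ih (n - 1) (by omega) p hpW b hb (by omega)
          (by simp only [itv, Set.mem_ofPred_eq]; omega)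
      have hat : G.dist a t = 2 := by
        have := hG.1.dist_triangle (u := a) (v := p) (w := t)
        have := hG.1.dist_triangle (u := a) (v := t) (w := b)
        omega
      exact (not_mem_Wd hG hxy).2 na (local_convex hG hxy ha htW hat haa.symm ta)
  exact fun a ha b hb => key _ a ha b hb rfl

lemma Wd_half (hG : IsMedianGraph G) {x y : V} (hxy : G.Adj x y) : IsHalfspace G (Wd G x y) := by
  have d := SimpleGraph.dist_eq_one_iff_adj.2 hxy
  have d' := SimpleGraph.dist_eq_one_iff_adj.2 hxy.symm
  refine ⟨⟨x, ?_⟩, ?_, Wd_convex hG hxy, ?_⟩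
  · simp [Wd, d]
  · rw [Wd_compl hG hxy]
    exact ⟨y, by simp [Wd, d']⟩
  · rw [Wd_compl hG hxy]
    exact Wd_convex hG hxy.symm

lemma half_eq (hG : IsMedianGraph G) {x y : V} (hxy : G.Adj x y) {h : Set V}
    (hh : IsHalfspace G h) (hx : x ∈ h) (hy : y ∉ h) : h = Wd G x y := by
  have d := SimpleGraph.dist_eq_one_iff_adj.2 hxy
  have d' := SimpleGraph.dist_eq_one_iff_adj.2 hxy.symm
  ext z
  constructor
  · intro hz
    by_contra hn
    rw [not_mem_Wd hG hxy] at hn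
    exact hy (hh.2.2.1 z hz x hx (by simp only [itv, Set.mem_ofPred_eq]; omega))
  · intro hz
    by_contra hn
    have hz : G.dist z y = G.dist z x + 1 := hz
    exact hh.2.2.2 z hn y hy (show x ∈ itv G z y by
      simp only [itv, Set.mem_ofPred_eq]; omega) hx

lemma last_step (hG : IsMedianGraph G) {a c : V} (hac : a ≠ c) :
    ∃ p, G.Adj p c ∧ G.dist a c = G.dist a p + 1 := by
  obtain ⟨p, h1, h2⟩ := first_step hG hac.symm
  refine ⟨p, h1.symm, ?_⟩
  rw [G.dist_comm (u := a) (v := c), G.dist_comm (u := a) (v := p), h2]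

lemma sep_dist (hG : IsMedianGraph G) : ∀ (n : ℕ) (x y : V), G.dist x y = n →
    (sep {h | IsHalfspace G h} x y).encard = n := by
  intro n
  induction n with
  | zero =>
    intro x y h
    have := hG.1.dist_eq_zero_iff.1 h
    subst this
    have : sep {h | IsHalfspace G h} x x = ∅ := by
      ext h; simp [sep]
    simp [this]
  | succ n ih =>
    intro x y hn
    have hne : x ≠ y := by rintro rfl; simp at hn
    obtain ⟨p, hp, hd⟩ := last_step hG hne
    have dp := SimpleGraph.dist_eq_one_iff_adj.2 hp
    have e : sep {h | IsHalfspace G h} x y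
        = insert (Wd G p y) (sep {h | IsHalfspace G h} x p) := by
      ext h
      constructor
      · rintro ⟨h1, h2, h3⟩
        by_cases hph : p ∈ h
        · exact Or.inl (half_eq hG hp h1 hph h3)
        · exact Or.inr ⟨h1, h2, hph⟩
      · rintro (rfl | ⟨h1, h2, h3⟩)
        · exact ⟨Wd_half hG hp, hd, by simp [Wd]⟩
        · refine ⟨h1, h2, fun hy => h3 ?_⟩
          exact h1.2.2.1 x h2 y hy (by simp only [itv, Set.mem_ofPred_eq]; omega)
    have hnot : Wd G p y ∉ sep {h | IsHalfspace G h} x p := by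
      rintro ⟨-, -, h3⟩
      exact h3 (by simp [Wd, dp])
    rw [e, Set.encard_insert_of_notMem hnot, ih x p (by omega)]
    norm_cast

lemma half_WS (hG : IsMedianGraph G) {η : ℕ} (hdim : DimLE G η) :
    WS {h | IsHalfspace G h} η := by
  refine ⟨?_, ?_, ?_⟩
  · rintro h ⟨h1, h2, h3, h4⟩
    exact ⟨h2, by rwa [compl_compl], h4, by rwa [compl_compl]⟩
  · intro x y
    exact Set.finite_of_encard_eq_coe (sep_dist hG _ x y rfl)
  · exact fun F hF hc => hdim F hF hc

lemma wd_eq (hG : IsMedianGraph G) (x y : V) : wd {h | IsHalfspace G h} x y = G.dist x y := by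
  rw [wd, Set.ncard, sep_dist hG _ x y rfl]
  rfl

end median

end MedianGraph

/-- The vertex set of a median graph of finite dimension, with the
edge-path metric, has finite asymptotic dimension. -/
theorem median_graph_finite_asdim {V : Type*} (G : SimpleGraph V)
    (hG : IsMedianGraph G) (η : ℕ) (hdim : DimLE G η) :
    ∃ n : ℕ, AsdimLE (fun x y : V => (G.dist x y : ℝ)) n := by
  classical
  obtain ⟨N, hN⟩ := wall_main (V := V) η
  refine ⟨N, fun r _ => ?_⟩
  obtain ⟨R, hR⟩ := hN ⌈r⌉₊
  obtain ⟨c, hc⟩ := hR _ (half_WS hG hdim)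
  set S := step {h | IsHalfspace G h} ⌈r⌉₊ c with hS
  have hsymm : ∀ a b, S a b → S b a := by
    rintro a b ⟨h1, h2⟩
    exact ⟨h1.symm, by rwa [wd_symm (half_WS hG hdim)]⟩
  have hrs : ∀ a b, Relation.ReflTransGen S a b → Relation.ReflTransGen S b a := by
    intro a b h
    induction h with
    | refl => exact .refl
    | tail _ h2 ih => exact .head (hsymm _ _ h2) ih
  have hcol : ∀ a b, Relation.ReflTransGen S a b → c a = c b := by
    intro a b h
    induction h with
    | refl => rfl
    | tail _ h2 ih => exact ih.trans h2.1
  refine ⟨fun i => {u | ∃ x, (c x).castSucc = i ∧ u = {y | Relation.ReflTransGen S x y}}, R,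
    ?_, ?_, ?_⟩
  · intro x
    exact ⟨(c x).castSucc, _, ⟨x, rfl, rfl⟩, .refl⟩
  · rintro i u ⟨x, hx, rfl⟩ v ⟨y, hy, rfl⟩ huv a ha b hb
    by_contra hlt
    push Not at hlt
    have ha : Relation.ReflTransGen S x a := ha
    have hb : Relation.ReflTransGen S y b := hb
    have hxy : c x = c y := Fin.castSucc_injective _ (hx.trans hy.symm)
    have hab : S a b := by
      refine ⟨?_, ?_⟩
      · rw [← hcol _ _ ha, ← hcol _ _ hb, hxy]
      · rw [wd_eq hG]
        exact_mod_cast hlt.le.trans (Nat.le_ceil r)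
    have hxy' : Relation.ReflTransGen S x y := (ha.tail hab).trans (hrs _ _ hb)
    apply huv
    ext z
    exact ⟨fun hz => (hrs _ _ hxy').trans hz, fun hz => hxy'.trans hz⟩
  · rintro i u ⟨x, hx, rfl⟩ a ha b hb
    have := hc a b ((hrs _ _ ha).trans hb)
    rw [wd_eq hG] at this
    change ((G.dist a b : ℕ) : ℝ) ≤ (R : ℝ)
    exact_mod_cast this
end

section
/- Let V be the vertex set of a connected simple graph equipped with the edge-path metric ρ, and suppose there are constants c₀, c > 1 such that every closed ball B(x,r) with r ≥ 1 contains at most c₀·c^r points (uniform local finiteness with at most exponential volume growth). Suppose μ is a coarse median on (V,ρ) of rank at most η, for some η ∈ ℕ. Then V has subexponential asymptotic dimension growth: there exists a function f : ℝ₊ → ℝ₊ with ad_V ⪯ f and log(f(r))/r → 0 as r → ∞. -/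
open scoped ENNReal

namespace AsdimGrowth

variable {X : Type*}

/-- `U` is a cover of `X`. -/
def IsCover (U : Set (Set X)) : Prop := ∀ x : X, ∃ u ∈ U, x ∈ u

/-- A family of subsets is uniformly bounded if the diameters of its members
admit a common finite bound. -/
def UnifBdd (d : X → X → ℝ) (U : Set (Set X)) : Prop :=
  ∃ R : ℝ, ∀ u ∈ U, ∀ a ∈ u, ∀ b ∈ u, d a b ≤ R

/-- The multiplicity of a family: the supremum over points `x` of the number of
members containing `x` (an extended natural number). -/
noncomputable def mult (U : Set (Set X)) : ℕ∞ :=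
  ⨆ x : X, {u | u ∈ U ∧ x ∈ u}.encard

/-- `LebGT d U lam` says the Lebesgue number of `U` exceeds `lam`: there is `l > lam`
such that every subset of diameter at most `l` lies in some member of `U`. -/
def LebGT (d : X → X → ℝ) (U : Set (Set X)) (lam : ℝ) : Prop :=
  ∃ l : ℝ, lam < l ∧ ∀ A : Set X, (∀ a ∈ A, ∀ b ∈ A, d a b ≤ l) → ∃ u ∈ U, A ⊆ u

/-- The asymptotic dimension function `ad_X(lam)`: the least multiplicity of a
uniformly bounded cover of Lebesgue number `> lam`, minus one (`∞` if there is no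
such cover). -/
noncomputable def adFun (d : X → X → ℝ) (lam : ℝ) : ℕ∞ :=
  sInf {m : ℕ∞ | ∃ U : Set (Set X),
    IsCover U ∧ UnifBdd d U ∧ LebGT d U lam ∧ mult U = m} - 1

/-- The asymptotic dimension function, valued in `ℝ≥0∞`. -/
noncomputable def adFunE (d : X → X → ℝ) : ℝ → ℝ≥0∞ :=
  fun lam => (adFun d lam : ℝ≥0∞)

/-- Growth domination of functions: `f ⪯ g` iff there is `k ∈ ℕ` with
`f(x) ≤ k·g(kx+k)+k` for all `x > k`. -/
def FDom (f g : ℝ → ℝ≥0∞) : Prop :=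
  ∃ k : ℕ, ∀ x : ℝ, (k : ℝ) < x → f x ≤ k * g (k * x + k) + k

/-- Growth equivalence of functions: `f ≈ g` iff `f ⪯ g` and `g ⪯ f`. -/
def FEquiv (f g : ℝ → ℝ≥0∞) : Prop := FDom f g ∧ FDom g f

end AsdimGrowth

open scoped ENNReal

namespace CoarseMedian

/-- A ternary operation is a median-algebra operation if it satisfies the median
axioms M1 (absorption), M2 (symmetry) and M3 (the median law). -/
def IsMedianAlgOp {M : Type*} (m : M → M → M → M) : Prop :=
  (∀ x y : M, m x x y = x) ∧
  (∀ x y z : M, m x y z = m x z y ∧ m x y z = m y x z ∧ m x y z = m y z x ∧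
    m x y z = m z x y ∧ m x y z = m z y x) ∧
  (∀ x y z u v : M, m (m x y z) u v = m (m x u v) (m y u v) z)

/-- The coordinatewise majority median on the discrete cube `{0,1}^d`. -/
def majCube (d : ℕ) (a b c : Fin d → Bool) : Fin d → Bool :=
  fun i => (a i && b i) || (b i && c i) || (a i && c i)

/-- A median-algebra operation has rank at most `η` if the algebra admits no injective
median-preserving map from the cube `{0,1}^{η+1}` with its majority median. -/
def OpRankLE {M : Type*} (m : M → M → M → M) (η : ℕ) : Prop :=
  ¬ ∃ f : (Fin (η + 1) → Bool) → M, Function.Injective f ∧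
      ∀ a b c : Fin (η + 1) → Bool, f (majCube (η + 1) a b c) = m (f a) (f b) (f c)

/-- `μ` is a coarse median of rank at most `η` on the space with distance function `ρ`,
with parameters `K` and `H`: the axioms M1, M2, the coarse Lipschitz condition (C1) with
constants `K, H(0)`, and the finite approximation condition (C2) by finite median
algebras of rank at most `η`, with control function `H`. -/
def IsCoarseMedianRank {X : Type*} (ρ : X → X → ℝ) (μ : X → X → X → X)
    (K : ℝ) (H : ℕ → ℝ) (η : ℕ) : Prop :=
  (∀ a b : X, μ a a b = a) ∧
  (∀ a b c : X, μ a b c = μ a c b ∧ μ a b c = μ b a c ∧ μ a b c = μ b c a ∧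
    μ a b c = μ c a b ∧ μ a b c = μ c b a) ∧
  (∀ a b c a' b' c' : X,
    ρ (μ a b c) (μ a' b' c') ≤ K * (ρ a a' + ρ b b' + ρ c c') + H 0) ∧
  (∀ p : ℕ, 1 ≤ p → ∀ A : Finset X, A.Nonempty → A.card ≤ p →
    ∃ (M : Type) (_ : Fintype M) (m : M → M → M → M),
      IsMedianAlgOp m ∧ OpRankLE m η ∧
      ∃ (π : X → M) (lam : M → X),
        (∀ x y z : M, ρ (lam (m x y z)) (μ (lam x) (lam y) (lam z)) ≤ H p) ∧
        (∀ a ∈ A, ρ a (lam (π a)) ≤ H p))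

end CoarseMedian

namespace CMProof

/-- Dilworth's theorem for finite sets (Galvin's proof). -/
theorem dilworth_aux {α : Type*} [PartialOrder α] (n : ℕ) : ∀ s : Finset α, s.card = n →
    ∃ k : ℕ, (∃ A : Finset α, A ⊆ s ∧ IsAntichain (· ≤ ·) (A : Set α) ∧ A.card = k) ∧
      ∃ c : α → ℕ, (∀ x ∈ s, c x < k) ∧
        ∀ x ∈ s, ∀ y ∈ s, c x = c y → x ≤ y ∨ y ≤ x := by
  classical
  induction n using Nat.strong_induction_on with
  | _ n ih =>
  intro s hs
  rcases s.eq_empty_or_nonempty with rfl | hne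
  · exact ⟨0, ⟨∅, by simp⟩, fun _ => 0, by simp, by simp⟩
  obtain ⟨a, ha⟩ := s.exists_maximal hne
  have hamem : a ∈ s := ha.prop
  obtain ⟨k, ⟨A0, hA0s, hA0, hA0c⟩, c, hc, hcc⟩ := ih (s.erase a).card
    (by rw [← hs]; exact Finset.card_erase_lt_of_mem hamem) (s.erase a) rfl
  -- colours are injective on antichains
  have hinj : ∀ B : Finset α, B ⊆ s.erase a → IsAntichain (· ≤ ·) (B : Set α) →
      Set.InjOn c B := by
    intro B hB hanti x hx y hy hxy
    by_contra hne
    rcases hcc x (hB hx) y (hB hy) hxy with h | h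
    · exact hanti hx hy hne h
    · exact hanti hy hx (Ne.symm hne) h
  have hle : ∀ B : Finset α, B ⊆ s.erase a → IsAntichain (· ≤ ·) (B : Set α) → B.card ≤ k := by
    intro B hB hanti
    have := Finset.card_le_card_of_injOn (t := Finset.range k) c
      (fun x hx => by simpa using hc x (hB hx)) (hinj B hB hanti)
    simpa using this
  have hsurj : ∀ B : Finset α, B ⊆ s.erase a → IsAntichain (· ≤ ·) (B : Set α) → B.card = k →
      ∀ i < k, ∃ y ∈ B, c y = i := by
    intro B hB hanti hBc i hi
    have himg : B.image c = Finset.range k := by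
      apply Finset.eq_of_subset_of_card_le
      · intro j hj
        obtain ⟨x, hx, rfl⟩ := Finset.mem_image.1 hj
        simpa using hc x (hB hx)
      · rw [Finset.card_image_of_injOn (hinj B hB hanti), hBc]; simp
    have : i ∈ B.image c := by rw [himg]; simpa using hi
    simpa using this
  -- the top elements
  have hx : ∀ i : ℕ, i < k → ∃ x ∈ s.erase a, c x = i ∧
      (∃ B : Finset α, B ⊆ s.erase a ∧ IsAntichain (· ≤ ·) (B : Set α) ∧ B.card = k ∧ x ∈ B) ∧
      ∀ B : Finset α, B ⊆ s.erase a → IsAntichain (· ≤ ·) (B : Set α) → B.card = k →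
        ∀ y ∈ B, c y = i → y ≤ x := by
    intro i hi
    let T := (s.erase a).filter (fun x => c x = i ∧
      ∃ B : Finset α, B ⊆ s.erase a ∧ IsAntichain (· ≤ ·) (B : Set α) ∧ B.card = k ∧ x ∈ B)
    have hT : T.Nonempty := by
      obtain ⟨y, hy, hyi⟩ := hsurj A0 hA0s hA0 hA0c i hi
      exact ⟨y, by simp only [T, Finset.mem_filter]; exact ⟨hA0s hy, hyi, A0, hA0s, hA0, hA0c, hy⟩⟩
    obtain ⟨x, hxm⟩ := T.exists_maximal hT
    have hxT := hxm.prop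
    simp only [T, Finset.mem_filter] at hxT
    refine ⟨x, hxT.1, hxT.2.1, hxT.2.2, ?_⟩
    intro B hB hanti hBc y hy hyi
    have hyT : y ∈ T := by
      simp only [T, Finset.mem_filter]; exact ⟨hB hy, hyi, B, hB, hanti, hBc, hy⟩
    rcases hcc x hxT.1 y (hB hy) (by rw [hxT.2.1, hyi]) with h | h
    · exact hxm.le_of_ge hyT h
    · exact h
  have : Nonempty α := ⟨a⟩
  choose! x hxs hxc hxB hxmax using hx
  by_cases hcase : ∃ i < k, x i ≤ a
  · obtain ⟨i, hi, hia⟩ := hcase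
    let Kc := s.filter (fun z => z = a ∨ (c z = i ∧ z ≤ x i))
    have hsub : s \ Kc ⊆ s.erase a := by
      intro z hz
      simp only [Kc, Finset.mem_sdiff, Finset.mem_filter, not_and, not_or] at hz
      exact Finset.mem_erase.2 ⟨(hz.2 hz.1).1, hz.1⟩
    obtain ⟨k1, ⟨A1, hA1s, hA1, hA1c⟩, c1, hc1, hcc1⟩ := ih (s \ Kc).card (by
      rw [← hs]
      refine lt_of_le_of_lt (Finset.card_le_card hsub) (Finset.card_erase_lt_of_mem hamem))
      (s \ Kc) rfl
    have hk1 : k1 < k := by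
      refine lt_of_le_of_ne (hA1c ▸ hle A1 (hA1s.trans hsub) hA1) ?_
      rintro rfl
      obtain ⟨y, hy, hyi⟩ := hsurj A1 (hA1s.trans hsub) hA1 hA1c i hi
      have := hxmax i hi A1 (hA1s.trans hsub) hA1 hA1c y hy hyi
      have h2 := hA1s hy
      simp only [Kc, Finset.mem_sdiff, Finset.mem_filter, not_and, not_or] at h2
      exact (h2.2 h2.1).2 hyi this
    refine ⟨k, ⟨A0, hA0s.trans (Finset.erase_subset _ _), hA0, hA0c⟩,
      fun z => if z ∈ Kc then k1 else c1 z, ?_, ?_⟩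
    · intro z hz
      dsimp only
      split_ifs with h
      · exact hk1
      · exact (hc1 z (Finset.mem_sdiff.2 ⟨hz, h⟩)).trans hk1
    · intro z hz w hw hzw
      dsimp only at hzw
      split_ifs at hzw with h1 h2 h2
      · simp only [Kc, Finset.mem_filter] at h1 h2
        rcases h1.2 with rfl | h1' <;> rcases h2.2 with rfl | h2'
        · exact Or.inl le_rfl
        · exact Or.inr (h2'.2.trans hia)
        · exact Or.inl (h1'.2.trans hia)
        · have hza : z ∈ s.erase a ∨ z = a := by
            by_cases h : z = a
            · exact Or.inr h
            · exact Or.inl (Finset.mem_erase.2 ⟨h, hz⟩)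
          have hwa : w ∈ s.erase a ∨ w = a := by
            by_cases h : w = a
            · exact Or.inr h
            · exact Or.inl (Finset.mem_erase.2 ⟨h, hw⟩)
          rcases hza with hza | rfl
          · rcases hwa with hwa | rfl
            · exact hcc z hza w hwa (h1'.1.trans h2'.1.symm)
            · exact Or.inl (h1'.2.trans hia)
          · exact Or.inr (h2'.2.trans hia)
      · have := hc1 w (Finset.mem_sdiff.2 ⟨hw, h2⟩); omega
      · have := hc1 z (Finset.mem_sdiff.2 ⟨hz, h1⟩); omega
      · exact hcc1 z (Finset.mem_sdiff.2 ⟨hz, h1⟩) w (Finset.mem_sdiff.2 ⟨hw, h2⟩) hzw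
  · push Not at hcase
    have hxinj : Set.InjOn x (Finset.range k : Set ℕ) := by
      intro i hi j hj hij
      have h1 := hxc i (by simpa using hi)
      have h2 := hxc j (by simpa using hj)
      rw [← h1, ← h2, hij]
    have hanot : a ∉ (Finset.range k).image x := by
      intro h
      obtain ⟨i, hi, hia⟩ := Finset.mem_image.1 h
      exact hcase i (by simpa using hi) hia.le
    refine ⟨k + 1, ⟨insert a ((Finset.range k).image x), ?_, ?_, ?_⟩,
      fun z => if z = a then k else c z, ?_, ?_⟩
    · intro z hz
      rcases Finset.mem_insert.1 hz with rfl | hz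
      · exact hamem
      · obtain ⟨i, hi, rfl⟩ := Finset.mem_image.1 hz
        exact Finset.mem_of_mem_erase (hxs i (by simpa using hi))
    · intro z hz w hw hne hzw
      rcases Finset.mem_insert.1 hz with hz' | hz' <;> rcases Finset.mem_insert.1 hw with hw' | hw'
      · exact hne (hz'.trans hw'.symm)
      · subst hz'
        obtain ⟨i, hi, rfl⟩ := Finset.mem_image.1 hw'
        have hi' := hxs i (by simpa using hi)
        exact hcase i (by simpa using hi) (ha.le_of_ge (Finset.mem_of_mem_erase hi') hzw)
      · obtain ⟨i, hi, rfl⟩ := Finset.mem_image.1 hz'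
        exact hcase i (by simpa using hi) (hw' ▸ hzw)
      · obtain ⟨i, hi, rfl⟩ := Finset.mem_image.1 hz'
        obtain ⟨j, hj, rfl⟩ := Finset.mem_image.1 hw'
        have hi' : i < k := by simpa using hi
        have hj' : j < k := by simpa using hj
        obtain ⟨B, hB, hanti, hBc, hjB⟩ := hxB j hj'
        obtain ⟨y, hy, hyi⟩ := hsurj B hB hanti hBc i hi'
        have h1 := hxmax i hi' B hB hanti hBc y hy hyi
        have h2 : y = x j := by
          by_contra hne'
          exact hanti hy hjB hne' (h1.trans hzw)
        have h3 := hxc j hj'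
        rw [← h2, hyi] at h3
        exact hne (by rw [h3])
    · rw [Finset.card_insert_of_notMem hanot, Finset.card_image_of_injOn hxinj]; simp
    · intro z hz
      dsimp only
      split_ifs with h
      · omega
      · have := hc z (Finset.mem_erase.2 ⟨h, hz⟩); omega
    · intro z hz w hw hzw
      dsimp only at hzw
      split_ifs at hzw with h1 h2 h2
      · exact Or.inl (h1.trans h2.symm).le
      · have := hc w (Finset.mem_erase.2 ⟨h2, hw⟩); omega
      · have := hc z (Finset.mem_erase.2 ⟨h1, hz⟩); omega
      · exact hcc z (Finset.mem_erase.2 ⟨h1, hz⟩) w (Finset.mem_erase.2 ⟨h2, hw⟩) hzw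

theorem dilworth {α : Type*} [PartialOrder α] (s : Finset α) (k : ℕ)
    (hw : ∀ A : Finset α, A ⊆ s → IsAntichain (· ≤ ·) (A : Set α) → A.card ≤ k) :
    ∃ c : α → ℕ, (∀ x ∈ s, c x < k) ∧ ∀ x ∈ s, ∀ y ∈ s, c x = c y → x ≤ y ∨ y ≤ x := by
  obtain ⟨k', ⟨A, hAs, hA, hAc⟩, c, hc, hcc⟩ := dilworth_aux s.card s rfl
  exact ⟨c, fun x hx => (hc x hx).trans_le (hAc ▸ hw A hAs hA), hcc⟩

/-- Erdos-Szekeres. -/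
theorem erdos_szekeres (n : ℕ) (S : Finset ℕ) (hS : n * n < S.card) (f : ℕ → ℕ) :
    ∃ T ⊆ S, n < T.card ∧ (MonotoneOn f (T : Set ℕ) ∨ AntitoneOn f (T : Set ℕ)) := by
  classical
  by_cases hw : ∀ A : Finset (ℕ × ℕ), A ⊆ S.image (fun i => (i, f i)) →
      IsAntichain (· ≤ ·) (A : Set (ℕ × ℕ)) → A.card ≤ n
  · obtain ⟨c, hc, hcc⟩ := dilworth _ n hw
    obtain ⟨j, hj, hjc⟩ := Finset.exists_lt_card_fiber_of_mul_lt_card_of_maps_to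
      (s := S) (t := Finset.range n) (f := fun i => c (i, f i)) (n := n)
      (fun i hi => by
        simpa using hc (i, f i) (Finset.mem_image_of_mem _ hi)) (by simpa using hS)
    refine ⟨_, Finset.filter_subset _ _, hjc, Or.inl ?_⟩
    intro a ha b hb hab
    simp only [Finset.coe_filter, Set.mem_ofPred_eq] at ha hb
    rcases hcc (a, f a) (Finset.mem_image_of_mem _ ha.1) (b, f b)
      (Finset.mem_image_of_mem _ hb.1) (ha.2.trans hb.2.symm) with h | h
    · exact h.2
    · have h1 : b ≤ a := h.1
      have : a = b := le_antisymm hab h1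
      rw [this]
  · push Not at hw
    obtain ⟨A, hA, hanti, hAc⟩ := hw
    have hAm : ∀ p ∈ A, p.1 ∈ S ∧ p.2 = f p.1 := by
      intro p hp
      obtain ⟨i, hi, rfl⟩ := Finset.mem_image.1 (hA hp)
      exact ⟨hi, rfl⟩
    have hinj : Set.InjOn Prod.fst (A : Set (ℕ × ℕ)) := by
      intro p hp q hq hpq
      exact Prod.ext hpq (by rw [(hAm p hp).2, (hAm q hq).2, hpq])
    refine ⟨A.image Prod.fst, ?_, ?_, Or.inr ?_⟩
    · intro i hi
      obtain ⟨p, hp, rfl⟩ := Finset.mem_image.1 hi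
      exact (hAm p hp).1
    · rwa [Finset.card_image_of_injOn hinj]
    · intro a ha b hb hab
      obtain ⟨p, hp, rfl⟩ := Finset.mem_image.1 (Finset.mem_coe.1 ha)
      obtain ⟨q, hq, rfl⟩ := Finset.mem_image.1 (Finset.mem_coe.1 hb)
      by_contra hlt
      push Not at hlt
      have hne : p ≠ q := by rintro rfl; exact lt_irrefl _ hlt
      exact hanti hp hq hne ⟨hab, by rw [(hAm p hp).2, (hAm q hq).2]; exact hlt.le⟩

/-- Iterated Erdos-Szekeres for finitely many coordinates. -/
theorem es_multi (η n : ℕ) : ∃ B : ℕ, ∀ S : Finset ℕ, B < S.card → ∀ f : ℕ → ℕ → ℕ,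
    ∃ T ⊆ S, n < T.card ∧ ∀ c < η, MonotoneOn (f c) (T : Set ℕ) ∨ AntitoneOn (f c) (T : Set ℕ) := by
  induction η with
  | zero => exact ⟨n, fun S hS f => ⟨S, subset_rfl, hS, by simp⟩⟩
  | succ η ih =>
    obtain ⟨B, hB⟩ := ih
    refine ⟨B * B, fun S hS f => ?_⟩
    obtain ⟨T, hT, hTc, hm⟩ := erdos_szekeres B S hS (f η)
    obtain ⟨T', hT', hTc', hm'⟩ := hB T hTc f
    refine ⟨T', hT'.trans hT, hTc', fun c hc => ?_⟩
    rcases Nat.lt_succ_iff_lt_or_eq.1 hc with h | rfl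
    · exact hm' c h
    · exact hm.imp (fun h => h.mono (by exact_mod_cast hT')) (fun h => h.mono (by exact_mod_cast hT'))

end CMProof

namespace CMProof
open CoarseMedian

/-- Majority of three Booleans. -/
def maj (a b c : Bool) : Bool := (a && b) || (b && c) || (a && c)

/-- Median homomorphisms to the two-point median algebra. -/
def IsHom {M : Type*} (m : M → M → M → M) (χ : M → Bool) : Prop :=
  ∀ x y z, χ (m x y z) = maj (χ x) (χ y) (χ z)

section
variable {M : Type*} {m : M → M → M → M}

theorem med_idem (hm : IsMedianAlgOp m) (x y z : M) : m x y (m x y z) = m x y z := by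
  obtain ⟨h1, h2, h3⟩ := hm
  have a := h3 x y z x y
  rw [h1 x y] at a
  have b : m y x y = y := by rw [(h2 y x y).1, h1]
  rw [b] at a
  rw [(h2 x y (m x y z)).2.2.2.1, a]

theorem med_distrib (hm : IsMedianAlgOp m) (x y u v w : M) :
    m x y (m u v w) = m (m x y u) (m x y v) (m x y w) := by
  have hid := fun z => med_idem hm x y z
  obtain ⟨h1, h2, h3⟩ := hm
  have key : ∀ u v w, m x y (m u v w) = m (m x y u) (m x y v) w := by
    intro u v w
    rw [(h2 x y (m u v w)).2.2.2.1, h3, (h2 x y u).2.2.2.1, (h2 x y v).2.2.2.1]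
  rw [← hid (m u v w), key u v w, (h2 (m x y u) (m x y v) w).2.2.2.1, key, hid]
  rw [← (h2 (m x y u) (m x y v) (m x y w)).2.2.2.1]

/-- Points of a finite median algebra are separated by homomorphisms to `Bool`. -/
theorem sep [Finite M] (hm : IsMedianAlgOp m) {x y : M} (hxy : x ≠ y) :
    ∃ χ : M → Bool, IsHom m χ ∧ χ x = false ∧ χ y = true := by
  classical
  have hd := med_distrib hm
  have hid := med_idem hm
  obtain ⟨h1, h2, h3⟩ := hm
  have h1' : ∀ a b, m a b b = b := fun a b => by rw [(h2 a b b).2.2.1, h1]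
  have h1'' : ∀ a b, m a b a = a := fun a b => by rw [(h2 a b a).1, h1]
  -- minimal interval
  obtain ⟨y', ⟨hy'x, hy'⟩, hmin⟩ : ∃ y', (y' ≠ x ∧ m x y y' = y') ∧
      ∀ z, (z ≠ x ∧ m x y z = z) → {w | m x y' w = w}.ncard ≤ {w | m x z w = w}.ncard := by
    have := Set.exists_min_image {z | z ≠ x ∧ m x y z = z} (fun z => {w | m x z w = w}.ncard)
      (Set.toFinite _) ⟨y, Ne.symm hxy, h1' x y⟩
    exact this
  have hbtw : ∀ z, m x y' z = x ∨ m x y' z = y' := by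
    intro z0
    by_contra hcon
    push Not at hcon
    obtain ⟨hzx, hzy⟩ := hcon
    set z := m x y' z0 with hz
    have hzz : m x y' z = z := hid x y' z0
    have hyz : m x y z = z := by
      have e1 := hd x y x y' z
      rw [hzz, h1'', hy'] at e1
      have e2 := hd x y' x y z
      rw [hzz, h1'', (h2 x y' y).1, hy', hzz] at e2
      rw [e1, e2]
    have hsub : {w | m x z w = w} ⊆ {w | m x y' w = w} := by
      intro w hw
      have hw' : m x z w = w := hw
      change m x y' w = w
      have e1 := hd x y' x z w
      rw [hw', h1'', hzz] at e1
      have e2 := hd x z x y' w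
      rw [hw', h1'', (h2 x z y').1, hzz, hw'] at e2
      rw [e1, e2]
    have hle := hmin z ⟨hzx, hyz⟩
    have heq := Set.eq_of_subset_of_ncard_le hsub hle (Set.toFinite _)
    have : y' ∈ {w | m x z w = w} := by rw [heq]; exact h1' x y'
    have h' : m x z y' = y' := this
    rw [(h2 x z y').1, hzz] at h'
    exact hzy h'
  refine ⟨fun z => decide (m x y' z = y'), ?_, ?_, ?_⟩
  · intro a b c
    simp only [hd x y' a b c]
    have hxy' : x ≠ y' := Ne.symm hy'x
    rcases hbtw a with ha | ha <;> rcases hbtw b with hb | hb <;> rcases hbtw c with hc | hc <;>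
      simp [ha, hb, hc, h1, h1', h1'', maj, hxy']
  · simp [h1'', Ne.symm hy'x]
  · have : m x y' y = y' := by rw [(h2 x y' y).1, hy']
    simp [this]

/-- Homomorphisms separating `α` (value `false`) from `β` (value `true`). -/
def Wall (m : M → M → M → M) (α β : M) (χ : M → Bool) : Prop :=
  IsHom m χ ∧ χ α = false ∧ χ β = true

theorem eq_of_walls [Finite M] (hm : IsMedianAlgOp m) {α β u v : M} (hu : m α u β = u)
    (hv : m α v β = v) (h : ∀ χ, Wall m α β χ → χ u = χ v) : u = v := by
  by_contra hne
  obtain ⟨χ, hχ, h1, h2⟩ := sep hm hne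
  have e1 := hχ α u β
  have e2 := hχ α v β
  rw [hu] at e1
  rw [hv] at e2
  rw [h1] at e1
  rw [h2] at e2
  rcases ha : χ α with _ | _ <;> rcases hb : χ β with _ | _
  · simp [ha, hb, maj] at e2
  · have := h χ ⟨hχ, ha, hb⟩
    simp [h1, h2] at this
  · have := h (fun z => !(χ z)) ⟨fun x y z => by
      simp only [hχ x y z]
      rcases χ x <;> rcases χ y <;> rcases χ z <;> rfl, by simp [ha], by simp [hb]⟩
    simp [h1, h2] at this
  · simp [ha, hb, maj] at e1

/-- An identity valid in all homomorphic images in `Bool` holds. -/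
theorem eq_of_homs [Finite M] (hm : IsMedianAlgOp m) {u v : M}
    (h : ∀ χ, IsHom m χ → χ u = χ v) : u = v := by
  by_contra hne
  obtain ⟨χ, hχ, h1, h2⟩ := sep hm hne
  have := h χ hχ
  simp [h1, h2] at this

theorem mem_interval [Finite M] (hm : IsMedianAlgOp m) (α β z : M) :
    m α (m α z β) β = m α z β := by
  apply eq_of_homs hm
  intro χ hχ
  simp only [hχ _ _ _]
  rcases χ α <;> rcases χ β <;> rcases χ z <;> rfl

theorem exists_meet [Finite M] (hm : IsMedianAlgOp m) (α β : M) (l : List M) :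
    ∃ z, m α z β = z ∧ ∀ χ, Wall m α β χ → (χ z = true ↔ ∀ w ∈ l, χ w = true) := by
  induction l with
  | nil =>
    refine ⟨β, ?_, fun χ hχ => by simp [hχ.2.2]⟩
    rw [(hm.2.1 α β β).2.2.1, hm.1]
  | cons a l ih =>
    obtain ⟨z, hz, hz'⟩ := ih
    refine ⟨m α (m α a z) β, mem_interval hm _ _ _, fun χ hχ => ?_⟩
    have := hz' χ hχ
    simp only [List.mem_cons, forall_eq_or_imp, ← this]
    rw [hχ.1, hχ.1, hχ.2.1, hχ.2.2]
    rcases χ a <;> rcases χ z <;> simp [maj]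

theorem exists_join [Finite M] (hm : IsMedianAlgOp m) (α β : M) (l : List M) :
    ∃ z, m α z β = z ∧ ∀ χ, Wall m α β χ → (χ z = true ↔ ∃ w ∈ l, χ w = true) := by
  induction l with
  | nil =>
    refine ⟨α, ?_, fun χ hχ => by simp [hχ.2.1]⟩
    rw [hm.1]
  | cons a l ih =>
    obtain ⟨z, hz, hz'⟩ := ih
    refine ⟨m α (m a z β) β, mem_interval hm _ _ _, fun χ hχ => ?_⟩
    have := hz' χ hχ
    simp only [List.mem_cons, exists_eq_or_imp, ← this]
    rw [hχ.1, hχ.1, hχ.2.1, hχ.2.2]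
    rcases χ a <;> rcases χ z <;> simp [maj]

/-- Pairwise incomparable walls yield a cube. -/
theorem cube_of_antichain [Finite M] (hm : IsMedianAlgOp m) (α β : M) (n : ℕ)
    (w : Fin n → M → Bool) (hw : ∀ i, Wall m α β (w i))
    (hinc : ∀ i j, i ≠ j → ¬ w i ≤ w j) :
    ∃ f : (Fin n → Bool) → M, Function.Injective f ∧
      ∀ a b c : Fin n → Bool, f (majCube n a b c) = m (f a) (f b) (f c) := by
  classical
  have hz : ∀ i j, ∃ z, i ≠ j → w i z = true ∧ w j z = false := by
    intro i j
    by_cases hij : i = j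
    · exact ⟨α, fun h => absurd hij h⟩
    · have := hinc i j hij
      rw [Pi.le_def] at this
      push Not at this
      obtain ⟨z, hz⟩ := this
      refine ⟨z, fun _ => ?_⟩
      revert hz
      rcases w i z with _ | _ <;> rcases w j z with _ | _ <;> decide
  choose z hz using hz
  have hx : ∀ i, ∃ x, m α x β = x ∧ ∀ j, (w j x = true ↔ j = i) := by
    intro i
    obtain ⟨x, hx, hx'⟩ := exists_meet hm α β
      (((List.finRange n).filter (fun j => j ≠ i)).map (fun j => z i j))
    refine ⟨x, hx, fun j => ?_⟩
    rw [hx' _ (hw j)]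
    simp only [List.mem_map, List.mem_filter, List.mem_finRange, true_and, decide_eq_true_eq]
    constructor
    · intro h
      by_contra hji
      have := h (z i j) ⟨j, hji, rfl⟩
      rw [(hz i j (Ne.symm hji)).2] at this
      exact absurd this (by simp)
    · rintro rfl _ ⟨k, hk, rfl⟩
      exact (hz j k (Ne.symm hk)).1
  choose x hxI hx using hx
  -- the co-atoms
  have hy : ∀ i, ∃ y, m α y β = y ∧ ∀ χ, Wall m α β χ →
      (χ y = true ↔ ∃ k, k ≠ i ∧ χ (x k) = true) := by
    intro i
    obtain ⟨y, hy, hy'⟩ := exists_join hm α β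
      (((List.finRange n).filter (fun j => j ≠ i)).map (fun j => x j))
    refine ⟨y, hy, fun χ hχ => ?_⟩
    rw [hy' χ hχ]
    simp
  choose y hyI hy using hy
  obtain ⟨t, htI, ht⟩ := exists_join hm α β ((List.finRange n).map x)
  have hf : ∀ σ : Fin n → Bool, ∃ u, m α u β = u ∧ ∀ χ, Wall m α β χ →
      (χ u = true ↔ ((∃ k, χ (x k) = true) ∧ ∀ i, σ i = false → ∃ k, k ≠ i ∧ χ (x k) = true)) := by
    intro σ
    obtain ⟨u, hu, hu'⟩ := exists_meet hm α β
      (t :: ((List.finRange n).filter (fun j => σ j = false)).map y)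
    refine ⟨u, hu, fun χ hχ => ?_⟩
    rw [hu' χ hχ]
    simp only [List.mem_cons, forall_eq_or_imp, ht χ hχ]
    simp [hy _ χ hχ]
  choose f hfI hf using hf
  refine ⟨f, ?_, ?_⟩
  · intro σ τ hst
    funext i
    have key : ∀ σ, w i (f σ) = true ↔ σ i = true := by
      intro σ
      rw [hf σ _ (hw i)]
      simp only [hx]
      constructor
      · rintro ⟨_, h⟩
        by_contra hσ
        obtain ⟨k, hk, hk'⟩ := h i (by simpa using hσ)
        exact hk hk'.symm
      · intro hσ
        refine ⟨⟨i, rfl⟩, fun j hj => ⟨i, ?_, rfl⟩⟩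
        rintro rfl
        simp [hσ] at hj
    have h1 := key σ
    have h2 := key τ
    rw [hst] at h1
    rw [h1] at h2
    rcases hs : σ i <;> rcases ht : τ i <;> simp_all
  · intro a b c
    have hmI : m α (m (f a) (f b) (f c)) β = m (f a) (f b) (f c) := by
      have h := fun χ (hχ : IsHom m χ) => hχ
      apply eq_of_homs hm
      intro χ hχ
      have ea := hχ α (f a) β
      have eb := hχ α (f b) β
      have ec := hχ α (f c) β
      rw [hfI] at ea eb ec
      rw [hχ, hχ (f a)]
      revert ea eb ec
      rcases χ α <;> rcases χ β <;> rcases χ (f a) <;> rcases χ (f b) <;> rcases χ (f c) <;>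
        simp [maj]
    apply eq_of_walls hm (hfI _) hmI
    intro χ hχ
    rw [hχ.1]
    -- value is constant or a coordinate
    have hval : ∀ σ, (χ (f σ) = true ↔
        ((∃ k, χ (x k) = true) ∧ ∀ i, σ i = false → ∃ k, k ≠ i ∧ χ (x k) = true)) :=
      fun σ => hf σ χ hχ
    by_cases hne : ∃ k, χ (x k) = true
    · obtain ⟨k, hk⟩ := hne
      by_cases h2 : ∃ k', k' ≠ k ∧ χ (x k') = true
      · obtain ⟨k', hkk, hk'⟩ := h2
        have : ∀ σ, χ (f σ) = true := by
          intro σ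
          rw [hval]
          refine ⟨⟨k, hk⟩, fun i _ => ?_⟩
          by_cases hi : i = k
          · exact ⟨k', hi ▸ hkk, hk'⟩
          · exact ⟨k, Ne.symm hi, hk⟩
        simp [this, maj]
      · have : ∀ σ, χ (f σ) = σ k := by
          intro σ
          rw [Bool.eq_iff_iff, hval]
          constructor
          · rintro ⟨_, h⟩
            by_contra hσ
            exact h2 (h k (by simpa using hσ))
          · intro hσ
            refine ⟨⟨k, hk⟩, fun i hi => ⟨k, ?_, hk⟩⟩
            rintro rfl
            simp [hσ] at hi
        simp only [this]
        rfl
    · have : ∀ σ, χ (f σ) = false := by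
        intro σ
        rw [← Bool.not_eq_true, hval]
        exact fun h => hne h.1
      simp [this, maj]

/-- Median of three naturals. -/
def nmed (a b c : ℕ) : ℕ := max (max (min a b) (min b c)) (min a c)

theorem coords [Fintype M] (hm : IsMedianAlgOp m) {η : ℕ} (hr : OpRankLE m η) (α β : M) :
    ∃ x : ℕ → M → ℕ, (∀ c u v w, x c (m u v w) = nmed (x c u) (x c v) (x c w)) ∧
      ∀ u v, m α u β = u → m α v β = v → (∀ c < η, x c u = x c v) → u = v := by
  classical
  let P : Finset (M → Bool) := Finset.univ.filter (Wall m α β)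
  obtain ⟨col, hcol, hcomp⟩ := dilworth P η (by
    intro A hA hanti
    by_contra hlt
    push Not at hlt
    obtain ⟨A', hA', hcard⟩ := Finset.exists_subset_card_eq (show η + 1 ≤ A.card from hlt)
    let e := A'.equivFinOfCardEq hcard
    apply hr
    refine cube_of_antichain hm α β (η + 1) (fun i => (e.symm i : M → Bool)) ?_ ?_
    · intro i
      have := hA (hA' (e.symm i).2)
      simpa [P] using this
    · intro i j hij
      refine hanti (hA' (e.symm i).2) (hA' (e.symm j).2) ?_
      intro h
      exact hij (e.symm.injective (Subtype.ext h)))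
  let A : ℕ → M → Finset (M → Bool) := fun c u => P.filter (fun χ => col χ = c ∧ χ u = true)
  have hnest : ∀ c u v, A c u ⊆ A c v ∨ A c v ⊆ A c u := by
    intro c u v
    by_contra hcon
    push Not at hcon
    obtain ⟨h1, h2⟩ := hcon
    obtain ⟨χ, hχ, hχ'⟩ := Finset.not_subset.1 h1
    obtain ⟨ψ, hψ, hψ'⟩ := Finset.not_subset.1 h2
    simp only [A, Finset.mem_filter, not_and] at hχ hχ' hψ hψ'
    rcases hcomp χ hχ.1 ψ hψ.1 (hχ.2.1.trans hψ.2.1.symm) with h | h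
    · have : χ u ≤ ψ u := h u
      rw [hχ.2.2] at this
      exact hψ' hψ.1 hψ.2.1 (by revert this; cases ψ u <;> decide)
    · have : ψ v ≤ χ v := h v
      rw [hψ.2.2] at this
      exact hχ' hχ.1 hχ.2.1 (by revert this; cases χ v <;> decide)
  refine ⟨fun c u => (A c u).card, ?_, ?_⟩
  · intro c u v w
    have hA : A c (m u v w) = (A c u ∩ A c v) ∪ (A c v ∩ A c w) ∪ (A c u ∩ A c w) := by
      ext χ
      simp only [A, Finset.mem_filter, Finset.mem_union, Finset.mem_inter]
      constructor
      · rintro ⟨h1, h2, h3⟩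
        have hw : Wall m α β χ := by simpa [P] using h1
        rw [hw.1] at h3
        revert h3
        rcases χ u <;> rcases χ v <;> rcases χ w <;> simp [maj, h1, h2]
      · intro h
        have h1 : χ ∈ P := by tauto
        have h2 : col χ = c := by tauto
        have hw : Wall m α β χ := by simpa [P] using h1
        refine ⟨h1, h2, ?_⟩
        rw [hw.1]
        revert h
        rcases χ u <;> rcases χ v <;> rcases χ w <;> simp [maj]
    simp only [hA]
    have hcase : ∀ S T R : Finset (M → Bool), (S ⊆ T ∨ T ⊆ S) → (S ⊆ R ∨ R ⊆ S) →
        (T ⊆ R ∨ R ⊆ T) → ((S ∩ T) ∪ (T ∩ R) ∪ (S ∩ R)).card = nmed S.card T.card R.card := by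
      intro S T R h1 h2 h3
      unfold nmed
      rcases h1 with h1 | h1 <;> rcases h2 with h2 | h2 <;> rcases h3 with h3 | h3 <;>
      · have c1 := Finset.card_le_card h1
        have c2 := Finset.card_le_card h2
        have c3 := Finset.card_le_card h3
        simp only [Finset.inter_eq_left.2 h1, Finset.inter_eq_left.2 h2,
          Finset.inter_eq_left.2 h3, Finset.inter_eq_right.2 h1, Finset.inter_eq_right.2 h2,
          Finset.inter_eq_right.2 h3]
        simp only [Finset.union_eq_left.2 h1, Finset.union_eq_left.2 h2, Finset.union_self,
          Finset.union_eq_left.2 h3, Finset.union_eq_right.2 h1, Finset.union_eq_right.2 h2,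
          Finset.union_eq_right.2 h3]
        try omega
    exact hcase _ _ _ (hnest c u v) (hnest c u w) (hnest c v w)
  · intro u v hu hv hc
    apply eq_of_walls hm hu hv
    intro χ hχ
    have hχP : χ ∈ P := by simpa [P] using hχ
    have hcard := hc (col χ) (hcol χ hχP)
    have hset : A (col χ) u = A (col χ) v := by
      rcases hnest (col χ) u v with h | h
      · exact Finset.eq_of_subset_of_card_le h hcard.ge
      · exact (Finset.eq_of_subset_of_card_le h hcard.le).symm
    have := Finset.ext_iff.1 hset χ
    simp only [A, Finset.mem_filter, hχP, true_and] at this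
    rw [Bool.eq_iff_iff]
    exact this

end
end CMProof

namespace CMProof
open CoarseMedian

theorem core {M : Type*} [Fintype M] {m : M → M → M → M} (hm : IsMedianAlgOp m) {η : ℕ}
    (hr : OpRankLE m η) (α β : M) (mm B : ℕ)
    (hB : ∀ S : Finset ℕ, B < S.card → ∀ f : ℕ → ℕ → ℕ,
      ∃ T ⊆ S, (mm + 1) * η + 1 < T.card ∧
        ∀ c < η, MonotoneOn (f c) (T : Set ℕ) ∨ AntitoneOn (f c) (T : Set ℕ))
    (S : Finset ℕ) (hS : B < S.card)
    (e : ℕ → M) (he : ∀ i, m α (e i) β = e i) (g : ℕ → ℕ → ℕ → M)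
    (hg0 : ∀ i j, g i j 0 = e i) (hg1 : ∀ i j, g i j mm = e j) :
    ∃ i ∈ S, ∃ j ∈ S, i ≠ j ∧ ∃ i0 ∈ S, ∃ j0 ∈ S,
      m (e i) (g i0 j0 0) (e j) = e i ∧ m (e i) (g i0 j0 mm) (e j) = e j ∧
      ∃ Q : Finset M, Q.card ≤ 2 ^ η ∧ ∀ k ≤ mm, m (e i) (g i0 j0 k) (e j) ∈ Q := by
  classical
  obtain ⟨x, hx, hinj⟩ := coords hm hr α β
  obtain ⟨T, hTS, hTc, hmono⟩ := hB S hS (fun c i => x c (e i))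
  obtain ⟨last, hlast⟩ : ∃ last, T.card = last + 1 := ⟨T.card - 1, by omega⟩
  let t : ℕ → ℕ := fun i => if h : i < T.card then T.orderEmbOfFin rfl ⟨i, h⟩ else 0
  have htT : ∀ i, i < T.card → t i ∈ T := by
    intro i hi
    simp only [t, hi, dif_pos]
    exact Finset.orderEmbOfFin_mem _ _ _
  have htm : ∀ i j, i < j → j < T.card → t i < t j := by
    intro i j hij hj
    simp only [t, hij.trans hj, hj, dif_pos]
    exact (T.orderEmbOfFin rfl).strictMono hij
  have htm' : ∀ i j, i ≤ j → j < T.card → t i ≤ t j := by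
    intro i j hij hj
    rcases hij.eq_or_lt with rfl | h
    · exact le_rfl
    · exact (htm i j h hj).le
  -- coordinates along the sequence
  have hmon : ∀ c < η, (∀ i j, i ≤ j → j < T.card → x c (e (t i)) ≤ x c (e (t j))) ∨
      (∀ i j, i ≤ j → j < T.card → x c (e (t j)) ≤ x c (e (t i))) := by
    intro c hc
    rcases hmono c hc with h | h
    · exact Or.inl fun i j hij hj => h (htT i (hij.trans_lt hj)) (htT j hj) (htm' i j hij hj)
    · exact Or.inr fun i j hij hj => h (htT i (hij.trans_lt hj)) (htT j hj) (htm' i j hij hj)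
  set γ : ℕ → M := g (t 0) (t last) with hγ
  -- a good layer
  obtain ⟨i, hi, hgood⟩ : ∃ i < last, ∀ k ≤ mm, ∀ c < η,
      ¬ (min (x c (e (t i))) (x c (e (t (i + 1)))) < x c (γ k) ∧
        x c (γ k) < max (x c (e (t i))) (x c (e (t (i + 1))))) := by
    by_contra hcon
    push Not at hcon
    choose! kk hkk cc hcc hbad hbad' using hcon
    obtain ⟨i, hi, j, hj, hij, heq⟩ := Finset.exists_ne_map_eq_of_card_lt_of_maps_to
      (s := Finset.range last) (t := Finset.range (mm + 1) ×ˢ Finset.range η)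
      (f := fun i => (kk i, cc i)) (by simp only [Finset.card_product, Finset.card_range]; omega) (by
        intro i hi
        have hi' : i < last := by simpa using hi
        have h1 := hkk i hi'
        have h2 := hcc i hi'
        simp only [Finset.coe_product, Finset.coe_range, Set.mem_prod, Set.mem_Iio]
        omega)
    have main : ∀ i j, i < j → j < last → kk i = kk j → cc i = cc j → False := by
      intro i j hij hj h1 h2
      have a1 := hbad i (hij.trans hj)
      have a2 := hbad' i (hij.trans hj)
      have b1 := hbad j hj
      have b2 := hbad' j hj
      rw [← h1, ← h2] at b1 b2
      rcases hmon (cc i) (hcc i (hij.trans hj)) with h | h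
      · have e1 := h i (i + 1) (by omega) (by omega)
        have e2 := h (i + 1) j (by omega) (by omega)
        have e3 := h j (j + 1) (by omega) (by omega)
        omega
      · have e1 := h i (i + 1) (by omega) (by omega)
        have e2 := h (i + 1) j (by omega) (by omega)
        have e3 := h j (j + 1) (by omega) (by omega)
        omega
    have hi' : i < last := by simpa using hi
    have hj' : j < last := by simpa using hj
    have h1 : kk i = kk j := congrArg Prod.fst heq
    have h2 : cc i = cc j := congrArg Prod.snd heq
    rcases lt_or_gt_of_ne hij with h | h
    · exact main i j h hj' h1 h2
    · exact main j i h hi' h1.symm h2.symm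
  have hI : ∀ z, m α (m (e (t i)) z (e (t (i + 1)))) β = m (e (t i)) z (e (t (i + 1))) := by
    intro z
    apply eq_of_homs hm
    intro χ hχ
    have ea := hχ α (e (t i)) β
    have eb := hχ α (e (t (i + 1))) β
    rw [he] at ea eb
    rw [hχ, hχ (e (t i))]
    revert ea eb
    rcases χ α <;> rcases χ β <;> rcases χ (e (t i)) <;> rcases χ (e (t (i + 1))) <;>
      rcases χ z <;> simp [maj]
  refine ⟨t i, hTS (htT i (by omega)), t (i + 1), hTS (htT (i + 1) (by omega)),
    (htm i (i + 1) (by omega) (by omega)).ne, t 0, hTS (htT 0 (by omega)), t last,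
    hTS (htT last (by omega)), ?_, ?_, ?_⟩
  · apply hinj _ _ (hI _) (he _)
    intro c hc
    rw [hx, hg0]
    unfold nmed
    rcases hmon c hc with h | h
    · have e1 := h i (i + 1) (by omega) (by omega)
      have e2 := h 0 i (by omega) (by omega)
      omega
    · have e1 := h i (i + 1) (by omega) (by omega)
      have e2 := h 0 i (by omega) (by omega)
      omega
  · apply hinj _ _ (hI _) (he _)
    intro c hc
    rw [hx, hg1]
    unfold nmed
    rcases hmon c hc with h | h
    · have e1 := h i (i + 1) (by omega) (by omega)
      have e2 := h (i + 1) last (by omega) (by omega)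
      omega
    · have e1 := h i (i + 1) (by omega) (by omega)
      have e2 := h (i + 1) last (by omega) (by omega)
      omega
  · refine ⟨(Finset.range (mm + 1)).image (fun k => m (e (t i)) (γ k) (e (t (i + 1)))), ?_,
      fun k hk => Finset.mem_image.2 ⟨k, by simp; omega, rfl⟩⟩
    have hval : ∀ k ≤ mm, ∀ c < η, x c (m (e (t i)) (γ k) (e (t (i + 1)))) = x c (e (t i)) ∨
        x c (m (e (t i)) (γ k) (e (t (i + 1)))) = x c (e (t (i + 1))) := by
      intro k hk c hc
      have := hgood k hk c hc
      rw [hx]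
      unfold nmed
      omega
    have hle := Finset.card_le_card_of_injOn
      (s := (Finset.range (mm + 1)).image (fun k => m (e (t i)) (γ k) (e (t (i + 1)))))
      (t := (Finset.univ : Finset (Fin η → Bool)))
      (fun z c => decide (x c z = x c (e (t i)))) (by simp) (by
        intro z hz w hw hzw
        obtain ⟨k, hk, rfl⟩ := Finset.mem_image.1 (Finset.mem_coe.1 hz)
        obtain ⟨l, hl, rfl⟩ := Finset.mem_image.1 (Finset.mem_coe.1 hw)
        have hk' : k ≤ mm := by have := Finset.mem_range.1 hk; omega
        have hl' : l ≤ mm := by have := Finset.mem_range.1 hl; omega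
        apply hinj _ _ (hI _) (hI _)
        intro c hc
        have h1 := congrFun hzw ⟨c, hc⟩
        simp only [decide_eq_decide] at h1
        have h2 := hval k hk' c hc
        have h3 := hval l hl' c hc
        omega)
    simpa using hle

theorem path_bound {X : Type*} (d : X → X → ℝ) (hself : ∀ x, d x x = 0)
    (htri : ∀ x y z, d x z ≤ d x y + d y z) (v : ℕ → X) (mm : ℕ) (σ : ℝ) (hσ : 0 ≤ σ)
    (hstep : ∀ k < mm, d (v k) (v (k + 1)) ≤ σ) (n : ℕ) :
    ∀ k ≤ mm, ∀ Q : Finset X, Q.card ≤ n → (∀ j, k ≤ j → j ≤ mm → v j ∈ Q) →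
      d (v k) (v mm) ≤ n * σ := by
  classical
  induction n with
  | zero =>
    intro k hk Q hQ hv
    have := hv k le_rfl hk
    have hQ' : Q = ∅ := Finset.card_eq_zero.1 (by omega)
    simp [hQ'] at this
  | succ n ih =>
    intro k hk Q hQ hv
    let F := (Finset.Icc k mm).filter (fun j => v j = v k)
    have hF : F.Nonempty := ⟨k, by simp [F, hk]⟩
    obtain ⟨k', hk'F, hk'max⟩ : ∃ k' ∈ F, ∀ j ∈ F, j ≤ k' :=
      ⟨F.max' hF, F.max'_mem hF, fun j hj => F.le_max' j hj⟩
    simp only [F, Finset.mem_filter, Finset.mem_Icc] at hk'F hk'max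
    obtain ⟨⟨h1, h2⟩, h3⟩ := hk'F
    rw [← h3]
    rcases h2.eq_or_lt with rfl | h2
    · rw [hself]; positivity
    · have hQ2 : (Q.erase (v k)).card ≤ n := by
        rw [Finset.card_erase_of_mem (hv k le_rfl hk)]; omega
      have := ih (k' + 1) (by omega) (Q.erase (v k)) hQ2 (by
        intro j hj1 hj2
        refine Finset.mem_erase.2 ⟨fun h => ?_, hv j (by omega) hj2⟩
        have := hk'max j ⟨⟨by omega, hj2⟩, h⟩
        omega)
      have h4 := htri (v k') (v (k' + 1)) (v mm)
      have h5 := hstep k' h2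
      push_cast
      linarith

theorem geo {V : Type*} (G : SimpleGraph V) (hconn : G.Connected) (x y : V) (m q : ℕ)
    (h : G.dist x y ≤ m * q) :
    ∃ γ : ℕ → V, γ 0 = x ∧ γ m = y ∧ ∀ k, G.dist (γ k) (γ (k + 1)) ≤ q := by
  obtain ⟨p, hp⟩ := hconn.exists_walk_length_eq_dist x y
  have h1 : ∀ n, G.dist (p.getVert n) (p.getVert (n + 1)) ≤ 1 := by
    intro n
    by_cases hn : n < p.length
    · rw [SimpleGraph.dist_eq_one_iff_adj.2 (p.adj_getVert_succ hn)]
    · rw [p.getVert_of_length_le (by omega), p.getVert_of_length_le (by omega)]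
      simp
  have h2 : ∀ j n, G.dist (p.getVert n) (p.getVert (n + j)) ≤ j := by
    intro j
    induction j with
    | zero => intro n; simp
    | succ j ih =>
      intro n
      have := hconn.dist_triangle (u := p.getVert n) (v := p.getVert (n + j))
        (w := p.getVert (n + (j + 1)))
      have a := ih n
      have b := h1 (n + j)
      rw [← add_assoc] at *
      omega
  refine ⟨fun k => p.getVert (k * q), by simp, p.getVert_of_length_le (by omega), fun k => ?_⟩
  have := h2 q (k * q)
  simpa [add_mul] using this

end CMProof

namespace CMProof
open CoarseMedian

theorem interval_bound {V : Type*} (G : SimpleGraph V) (hconn : G.Connected)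
    (μ : V → V → V → V) (η : ℕ) (K : ℝ) (H : ℕ → ℝ) (hK : 1 ≤ K) (hH : ∀ p : ℕ, 0 ≤ H p)
    (hcm : IsCoarseMedianRank (fun x y : V => (G.dist x y : ℝ)) μ K H η)
    (ε D κ : ℝ) (hε : 0 < ε) (hD : 0 ≤ D) (hκ : 0 ≤ κ) :
    ∃ N : ℕ, ∃ r0 : ℝ, ∀ r ≥ r0, ∀ a b : V, ∀ E : Finset V,
      (∀ e ∈ E, (G.dist (μ a e b) e : ℝ) ≤ κ) →
      (∀ e ∈ E, ∀ e' ∈ E, e ≠ e' → ε * r < (G.dist e e' : ℝ)) →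
      (∀ e ∈ E, ∀ e' ∈ E, (G.dist e e' : ℝ) ≤ D * r) → E.card ≤ N := by
  classical
  obtain ⟨-, -, hC1, hC2⟩ := hcm
  obtain ⟨mm, hmm⟩ := exists_nat_gt (4 * 2 ^ η * K ^ 2 * D / ε)
  have hmm0 : (0 : ℝ) < mm := lt_of_le_of_lt (by positivity) hmm
  obtain ⟨B, hB⟩ := es_multi η ((mm + 1) * η + 1)
  let p : ℕ := 2 + (B + 1) + (B + 1) * ((B + 1) * (mm + 1))
  let h := H p
  have hh : 0 ≤ h := hH p
  have hH0 : 0 ≤ H 0 := hH 0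
  have hK0 : 0 ≤ K := by linarith
  let Cst : ℝ := 2 ^ η * (2 * h + H 0 + K * (2 * h + H 0 + K * (2 * h + 1))) +
    2 * (h + 3 * K * h + H 0 + κ)
  refine ⟨B, 2 * (Cst + 1) / ε, fun r hr a b E hE1 hE2 hE3 => ?_⟩
  by_contra hlt
  push Not at hlt
  have hCst : 0 ≤ Cst := by positivity
  have hr' : 2 * (Cst + 1) ≤ ε * r := by
    have := (div_le_iff₀ hε).1 hr
    linarith
  have hr0 : 0 ≤ r := le_trans (by positivity) hr
  -- enumerate
  obtain ⟨E', hE', hcard⟩ := Finset.exists_subset_card_eq (show B + 1 ≤ E.card from hlt)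
  let en := E'.equivFinOfCardEq hcard
  let e : ℕ → V := fun i => (en.symm (Fin.ofNat (B + 1) i) : V)
  have heE : ∀ i, e i ∈ E := fun i => hE' (en.symm _).2
  have hene : ∀ i < B + 1, ∀ j < B + 1, i ≠ j → e i ≠ e j := by
    intro i hi j hj hij heq
    have h1 := en.symm.injective (Subtype.ext heq)
    have h2 := congrArg Fin.val h1
    simp only [Fin.val_ofNat] at h2
    rw [Nat.mod_eq_of_lt hi, Nat.mod_eq_of_lt hj] at h2
    exact hij h2
  let q : ℕ := ⌈D * r / mm⌉₊
  have hq1 : D * r ≤ mm * q := by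
    have := Nat.le_ceil (D * r / mm)
    rw [div_le_iff₀ hmm0] at this
    linarith
  have hq2 : (q : ℝ) ≤ D * r / mm + 1 := (Nat.ceil_lt_add_one (by positivity)).le
  have hgeo : ∀ i j, ∃ γ : ℕ → V, γ 0 = e i ∧ γ mm = e j ∧
      ∀ k, G.dist (γ k) (γ (k + 1)) ≤ q := by
    intro i j
    apply geo G hconn
    have := (hE3 _ (heE i) _ (heE j)).trans hq1
    exact_mod_cast this
  choose γ hγ0 hγ1 hγ using hgeo
  let A1 : Finset V := (Finset.range (B + 1)).image e
  let A2 : Finset V := (Finset.range (B + 1) ×ˢ (Finset.range (B + 1) ×ˢ Finset.range (mm + 1))).image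
    (fun t => γ t.1 t.2.1 t.2.2)
  let A : Finset V := ({a, b} ∪ A1) ∪ A2
  have hAcard : A.card ≤ p := by
    have c1 : A1.card ≤ B + 1 := by
      simpa using Finset.card_image_le (s := Finset.range (B + 1)) (f := e)
    have c2 : A2.card ≤ (B + 1) * ((B + 1) * (mm + 1)) := by
      simpa using Finset.card_image_le
        (s := Finset.range (B + 1) ×ˢ (Finset.range (B + 1) ×ˢ Finset.range (mm + 1)))
        (f := fun t => γ t.1 t.2.1 t.2.2)
    have c3 : ({a, b} : Finset V).card ≤ 2 := Finset.card_le_two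
    have c4 := Finset.card_union_le ({a, b} ∪ A1) A2
    have c5 := Finset.card_union_le {a, b} A1
    simp only [A, p]
    omega
  have haA : a ∈ A := by simp [A]
  have hbA : b ∈ A := by simp [A]
  have heA : ∀ i < B + 1, e i ∈ A := by
    intro i hi
    refine Finset.mem_union_left _ (Finset.mem_union_right _ ?_)
    exact Finset.mem_image_of_mem _ (Finset.mem_range.2 hi)
  have hγA : ∀ i < B + 1, ∀ j < B + 1, ∀ k ≤ mm, γ i j k ∈ A := by
    intro i hi j hj k hk
    refine Finset.mem_union_right _ (Finset.mem_image.2 ⟨(i, j, k), ?_, rfl⟩)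
    simp only [Finset.mem_product, Finset.mem_range]
    omega
  obtain ⟨M, _, m, hm, hrk, π, lam, hlam, hπ⟩ := hC2 p (by simp only [p]; omega) A ⟨a, haA⟩ hAcard
  have htri : ∀ x y z : V, (G.dist x z : ℝ) ≤ G.dist x y + G.dist y z := by
    intro x y z; exact_mod_cast hconn.dist_triangle
  have hsym : ∀ x y : V, (G.dist x y : ℝ) = G.dist y x := by
    intro x y; rw [SimpleGraph.dist_comm]
  have hself : ∀ x : V, (G.dist x x : ℝ) = 0 := by intro x; simp
  have hnn : ∀ x y : V, (0 : ℝ) ≤ G.dist x y := fun x y => Nat.cast_nonneg _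
  have hlam' : ∀ x y z : M, (G.dist (lam (m x y z)) (μ (lam x) (lam y) (lam z)) : ℝ) ≤ h := hlam
  have hπ' : ∀ w ∈ A, (G.dist w (lam (π w)) : ℝ) ≤ h := hπ
  have hC1' : ∀ a b c a' b' c' : V, (G.dist (μ a b c) (μ a' b' c') : ℝ) ≤
    K * ((G.dist a a' : ℝ) + G.dist b b' + G.dist c c') + H 0 := hC1
  -- Lipschitz in the middle variable
  have hmid : ∀ x z z' y : M, (G.dist (lam (m x z y)) (lam (m x z' y)) : ℝ) ≤
      2 * h + H 0 + K * G.dist (lam z) (lam z') := by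
    intro x z z' y
    have t1 := htri (lam (m x z y)) (μ (lam x) (lam z) (lam y)) (lam (m x z' y))
    have t2 := htri (μ (lam x) (lam z) (lam y)) (μ (lam x) (lam z') (lam y)) (lam (m x z' y))
    have t3 := hlam' x z y
    have t4 := hlam' x z' y
    rw [hsym] at t4
    have t5 := hC1' (lam x) (lam z) (lam y) (lam x) (lam z') (lam y)
    rw [hself, hself] at t5
    linarith
  have hππ : ∀ w ∈ A, ∀ w' ∈ A, (G.dist (lam (π w)) (lam (π w')) : ℝ) ≤ 2 * h + G.dist w w' := by
    intro w hw w' hw'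
    have t1 := htri (lam (π w)) w (lam (π w'))
    have t2 := htri w w' (lam (π w'))
    have t3 := hπ' w hw
    have t4 := hπ' w' hw'
    rw [hsym] at t3
    linarith
  let ehat : ℕ → M := fun i => m (π a) (π (e i)) (π b)
  let g : ℕ → ℕ → ℕ → M := fun i j k => m (π a) (π (γ i j k)) (π b)
  have hehat : ∀ i < B + 1, (G.dist (lam (ehat i)) (e i) : ℝ) ≤ h + 3 * K * h + H 0 + κ := by
    intro i hi
    have t1 := htri (lam (ehat i)) (μ (lam (π a)) (lam (π (e i))) (lam (π b))) (e i)
    have t2 := htri (μ (lam (π a)) (lam (π (e i))) (lam (π b))) (μ a (e i) b) (e i)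
    have t3 := hlam' (π a) (π (e i)) (π b)
    have t4 := hC1' (lam (π a)) (lam (π (e i))) (lam (π b)) a (e i) b
    have t5 := hπ' a haA
    have t6 := hπ' b hbA
    have t7 := hπ' (e i) (heA i hi)
    have t8 := hE1 (e i) (heE i)
    rw [hsym] at t5 t6 t7
    have t9 : K * ((G.dist (lam (π a)) a : ℝ) + G.dist (lam (π (e i))) (e i) +
        G.dist (lam (π b)) b) ≤ K * (3 * h) :=
      mul_le_mul_of_nonneg_left (by linarith) hK0
    linarith
  obtain ⟨i, hi, j, hj, hij, i0, hi0, j0, hj0, hs, ht, Q, hQ, hQm⟩ :=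
    core hm hrk (π a) (π b) mm B hB (Finset.range (B + 1)) (by simp) ehat
      (fun i => mem_interval hm _ _ _) g (fun i j => by simp only [g, ehat, hγ0])
      (fun i j => by simp only [g, ehat, hγ1])
  rw [Finset.mem_range] at hi hj hi0 hj0
  let v : ℕ → V := fun k => lam (m (ehat i) (g i0 j0 k) (ehat j))
  let σ : ℝ := 2 * h + H 0 + K * (2 * h + H 0 + K * (2 * h + q))
  have hσ0 : 0 ≤ σ := by positivity
  have hstep : ∀ k < mm, (G.dist (v k) (v (k + 1)) : ℝ) ≤ σ := by
    intro k hk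
    have t1 := hmid (ehat i) (g i0 j0 k) (g i0 j0 (k + 1)) (ehat j)
    have t2 := hmid (π a) (π (γ i0 j0 k)) (π (γ i0 j0 (k + 1))) (π b)
    have t3 := hππ _ (hγA i0 hi0 j0 hj0 k hk.le) _ (hγA i0 hi0 j0 hj0 (k + 1) hk)
    have t4 : (G.dist (γ i0 j0 k) (γ i0 j0 (k + 1)) : ℝ) ≤ q := by exact_mod_cast hγ i0 j0 k
    have t5 : K * (G.dist (lam (π (γ i0 j0 k))) (lam (π (γ i0 j0 (k + 1)))) : ℝ) ≤
      K * (2 * h + q) := mul_le_mul_of_nonneg_left (by linarith) hK0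
    have t6 : K * (G.dist (lam (g i0 j0 k)) (lam (g i0 j0 (k + 1))) : ℝ) ≤
      K * (2 * h + H 0 + K * (2 * h + q)) := mul_le_mul_of_nonneg_left (by
        simp only [g]; linarith) hK0
    simp only [v, σ]
    linarith
  have hpath := path_bound (fun x y : V => (G.dist x y : ℝ)) hself htri v mm σ hσ0 hstep (2 ^ η)
    0 (Nat.zero_le _) (Q.image lam) (Finset.card_image_le.trans hQ)
    (fun k _ hk => Finset.mem_image_of_mem _ (hQm k hk))
  simp only [v, hs, ht] at hpath
  have u1 := hE2 _ (heE i) _ (heE j) (hene i hi j hj hij)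
  have u2 := htri (e i) (lam (ehat i)) (e j)
  have u3 := htri (lam (ehat i)) (lam (ehat j)) (e j)
  have u4 := hehat i hi
  have u5 := hehat j hj
  rw [hsym] at u4
  have u6 : ε * r < ((2 ^ η : ℕ) : ℝ) * σ + 2 * (h + 3 * K * h + H 0 + κ) := by linarith
  have u7 : (2 : ℝ) ^ η * σ ≤ 2 ^ η * (2 * h + H 0 + K * (2 * h + H 0 + K * (2 * h + 1))) +
      2 ^ η * K ^ 2 * (D * r / mm) := by
    have : σ ≤ 2 * h + H 0 + K * (2 * h + H 0 + K * (2 * h + (D * r / mm + 1))) := by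
      simp only [σ]; gcongr
    calc (2 : ℝ) ^ η * σ ≤ 2 ^ η * (2 * h + H 0 + K * (2 * h + H 0 + K * (2 * h + (D * r / mm + 1)))) := by
          gcongr
      _ = _ := by ring
  have u8 : 2 ^ η * K ^ 2 * (D * r / mm) ≤ ε * r / 4 := by
    rw [div_lt_iff₀ hε] at hmm
    have : 2 ^ η * K ^ 2 * (D * r / mm) = (2 ^ η * K ^ 2 * D) * r / mm := by ring
    rw [this, div_le_iff₀ hmm0]
    nlinarith
  push_cast at u6
  simp only [Cst] at hr'
  nlinarith

end CMProof

namespace CMProof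
open CoarseMedian AsdimGrowth

/-- Ternary terms in variables from `ι`. -/
inductive Tm (ι : Type) : Type
  | var (i : ι) : Tm ι
  | med (t1 t2 t3 : Tm ι) : Tm ι

/-- Evaluation of a term. -/
def Tm.ev {ι : Type} {X : Type*} (m : X → X → X → X) (v : ι → X) : Tm ι → X
  | .var i => v i
  | .med t1 t2 t3 => m (t1.ev m v) (t2.ev m v) (t3.ev m v)

/-- Accumulated error of a term. -/
noncomputable def Tm.err {ι : Type} (K h0 hp : ℝ) : Tm ι → ℝ
  | .var _ => hp
  | .med t1 t2 t3 => hp + (K * (t1.err K h0 hp + t2.err K h0 hp + t3.err K h0 hp) + h0)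

theorem Tm.err_nonneg {ι : Type} {K h0 hp : ℝ} (hK : 0 ≤ K) (h0' : 0 ≤ h0) (hp' : 0 ≤ hp)
    (t : Tm ι) : 0 ≤ t.err K h0 hp := by
  induction t with
  | var i => exact hp'
  | med t1 t2 t3 h1 h2 h3 => simp only [Tm.err]; positivity

theorem Tm.ev_hom {ι : Type} {M : Type*} {m : M → M → M → M} {χ : M → Bool} (hχ : IsHom m χ)
    (v : ι → M) (t : Tm ι) : χ (t.ev m v) = t.ev maj (fun i => χ (v i)) := by
  induction t with
  | var i => rfl
  | med t1 t2 t3 h1 h2 h3 => simp only [Tm.ev]; rw [hχ, h1, h2, h3]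

theorem tri {V : Type*} (G : SimpleGraph V) (hconn : G.Connected) (a b c : V) :
    (G.dist a c : ℝ) ≤ G.dist a b + G.dist b c := by
  exact_mod_cast hconn.dist_triangle

theorem dsymm {V : Type*} (G : SimpleGraph V) (a b : V) :
    (G.dist a b : ℝ) = G.dist b a := by
  rw [G.dist_comm]

theorem transfer {V : Type*} (G : SimpleGraph V) (hconn : G.Connected)
    (μ : V → V → V → V) (η : ℕ) (K : ℝ) (H : ℕ → ℝ)
    (hK : 1 ≤ K) (hH : ∀ p : ℕ, 0 ≤ H p)
    (hcm : IsCoarseMedianRank (fun x y : V => (G.dist x y : ℝ)) μ K H η)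
    {ι : Type} [Fintype ι] [Nonempty ι] (t1 t2 : Tm ι)
    (h : ∀ χ : ι → Bool, t1.ev maj χ = t2.ev maj χ) :
    ∃ C : ℝ, 0 ≤ C ∧ ∀ v : ι → V, (G.dist (t1.ev μ v) (t2.ev μ v) : ℝ) ≤ C := by
  classical
  obtain ⟨-, -, hC1, hC2⟩ := hcm
  have hK0 : 0 ≤ K := by linarith
  set hp := H (Fintype.card ι) with hhp
  refine ⟨t1.err K (H 0) hp + t2.err K (H 0) hp,
    add_nonneg (t1.err_nonneg hK0 (hH 0) (hH _)) (t2.err_nonneg hK0 (hH 0) (hH _)), fun v => ?_⟩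
  obtain ⟨M, _, m, hm, -, π, lam, hl, hπ⟩ := hC2 (Fintype.card ι) Fintype.card_pos
    (Finset.univ.image v) (by simp) (Finset.card_image_le)
  have key : ∀ t : Tm ι, (G.dist (t.ev μ v) (lam (t.ev m (fun i => π (v i)))) : ℝ) ≤
      t.err K (H 0) hp := by
    intro t
    induction t with
    | var i => exact hπ (v i) (by simp)
    | med s1 s2 s3 h1 h2 h3 =>
      simp only [Tm.ev, Tm.err]
      have a := hC1 (s1.ev μ v) (s2.ev μ v) (s3.ev μ v)
        (lam (s1.ev m (fun i => π (v i)))) (lam (s2.ev m (fun i => π (v i))))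
        (lam (s3.ev m (fun i => π (v i))))
      have b := hl (s1.ev m (fun i => π (v i))) (s2.ev m (fun i => π (v i)))
        (s3.ev m (fun i => π (v i)))
      dsimp only at a b
      rw [dsymm] at b
      have c := mul_le_mul_of_nonneg_left (add_le_add (add_le_add h1 h2) h3) hK0
      have e := tri G hconn (μ (s1.ev μ v) (s2.ev μ v) (s3.ev μ v))
        (μ (lam (s1.ev m (fun i => π (v i)))) (lam (s2.ev m (fun i => π (v i))))
          (lam (s3.ev m (fun i => π (v i)))))
        (lam (m (s1.ev m (fun i => π (v i))) (s2.ev m (fun i => π (v i)))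
        (s3.ev m (fun i => π (v i)))))
      linarith
  have heq : t1.ev m (fun i => π (v i)) = t2.ev m (fun i => π (v i)) := by
    apply eq_of_homs hm
    intro χ hχ
    rw [Tm.ev_hom hχ, Tm.ev_hom hχ, h]
  have k1 := key t1
  have k2 := key t2
  rw [← heq, dsymm] at k2
  have := tri G hconn (t1.ev μ v) (lam (t1.ev m (fun i => π (v i)))) (t2.ev μ v)
  linarith

/-- The iterated median towards `x0`. -/
def foldm {X : Type*} (m : X → X → X → X) (x0 : X) : List X → X → X
  | [], h => h
  | z :: l, h => foldm m x0 l (m h z x0)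

theorem ev_foldm {ι : Type} {X : Type*} (m : X → X → X → X) (v : ι → X) (x0 : Tm ι)
    (l : List (Tm ι)) (h : Tm ι) : (foldm Tm.med x0 l h).ev m v =
      foldm m (x0.ev m v) (l.map (fun t => t.ev m v)) (h.ev m v) := by
  induction l generalizing h with
  | nil => rfl
  | cons z l ih => simp only [foldm, List.map_cons]; rw [ih]; rfl

theorem foldm_x0 (x0 : Bool) (l : List Bool) : foldm maj x0 l x0 = x0 := by
  induction l with
  | nil => rfl
  | cons z l ih =>
    have : maj x0 z x0 = x0 := by cases x0 <;> cases z <;> rfl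
    simp only [foldm, this, ih]

theorem foldm_bool (x0 y : Bool) (hne : y ≠ x0) (l : List Bool) (z : Bool) (hz : z ∈ l) :
    maj y z (foldm maj x0 l y) = z := by
  induction l with
  | nil => simp at hz
  | cons w l ih =>
    by_cases hw : w = y
    · subst hw
      have : maj w w x0 = w := by cases x0 <;> cases w <;> rfl
      simp only [foldm, this]
      rcases List.mem_cons.1 hz with rfl | hz
      · generalize foldm maj x0 l z = q
        cases z <;> cases q <;> rfl
      · exact ih hz
    · have hw' : w = x0 := by cases w <;> cases y <;> cases x0 <;> simp_all
      subst hw'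
      have : maj y w w = w := by cases y <;> cases w <;> rfl
      simp only [foldm, this, foldm_x0]
      cases z <;> cases w <;> cases y <;> simp_all [maj]

theorem foldm_bool2 (x0 y : Bool) (l : List Bool) :
    maj y (foldm maj x0 l y) x0 = foldm maj x0 l y := by
  by_cases h : y = x0
  · subst h; rw [foldm_x0]; cases y <;> rfl
  · generalize foldm maj x0 l y = q
    cases y <;> cases x0 <;> cases q <;> simp_all [maj]

theorem net {V : Type*} (d : V → V → ℝ) (hd : ∀ a b, d a b = d b a) (hd0 : ∀ a, d a a = 0)
    (σ : ℝ) (hσ : 0 ≤ σ) (S : Set V)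
    (hS : S.Nonempty) (N : ℕ) (hN : ∀ E : Finset V, (∀ e ∈ E, e ∈ S) →
      (∀ e ∈ E, ∀ e' ∈ E, e ≠ e' → σ < d e e') → E.card ≤ N) :
    ∃ g : Fin N → V, (∀ i, g i ∈ S) ∧ ∀ s ∈ S, ∃ i, d s (g i) ≤ σ := by
  classical
  let P : ℕ → Prop := fun n => ∃ E : Finset V, (∀ e ∈ E, e ∈ S) ∧
      (∀ e ∈ E, ∀ e' ∈ E, e ≠ e' → σ < d e e') ∧ E.card = n
  have hP0 : P 0 := ⟨∅, by simp, by simp, by simp⟩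
  obtain ⟨E, hE1, hE2, hE3⟩ : P (Nat.findGreatest P N) := Nat.findGreatest_spec (Nat.zero_le _) hP0
  have hmax : ∀ F : Finset V, (∀ e ∈ F, e ∈ S) →
      (∀ e ∈ F, ∀ e' ∈ F, e ≠ e' → σ < d e e') → F.card ≤ E.card := by
    intro F h1 h2
    rw [hE3]
    exact Nat.le_findGreatest (hN F h1 h2) ⟨F, h1, h2, rfl⟩
  have hcov : ∀ s ∈ S, ∃ e ∈ E, d s e ≤ σ := by
    intro s hs
    by_contra hcon
    push Not at hcon
    have hsE : s ∉ E := fun h => by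
      have := hcon s h
      rw [hd0] at this
      linarith
    have := hmax (insert s E) (by
      intro e he
      rcases Finset.mem_insert.1 he with rfl | he
      · exact hs
      · exact hE1 e he) (by
      intro e he e' he' hne
      rcases Finset.mem_insert.1 he with h1 | h1 <;> rcases Finset.mem_insert.1 he' with h2 | h2
      · exact absurd (h1.trans h2.symm) hne
      · rw [h1]; exact hcon _ h2
      · rw [hd, h2]; exact hcon _ h1
      · exact hE2 e h1 e' h2 hne)
    rw [Finset.card_insert_of_notMem hsE] at this
    omega
  obtain ⟨s0, hs0⟩ := hS
  have hEN : E.card ≤ N := hN E hE1 hE2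
  refine ⟨fun i => if h : i.1 < E.card then (E.equivFin.symm ⟨i.1, h⟩ : V) else s0, ?_, ?_⟩
  · intro i
    dsimp only
    split_ifs with h
    · exact hE1 _ (E.equivFin.symm ⟨i.1, h⟩).2
    · exact hs0
  · intro s hs
    obtain ⟨e, he, hse⟩ := hcov s hs
    refine ⟨⟨(E.equivFin ⟨e, he⟩).1, lt_of_lt_of_le (E.equivFin ⟨e, he⟩).2 hEN⟩, ?_⟩
    simpa using hse

end CMProof

namespace CMProof
open CoarseMedian AsdimGrowth

/-- bound on iterated medians -/
noncomputable def fbd (K T : ℝ) : ℕ → ℝ → ℝ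
  | 0, A => A
  | n + 1, A => fbd K T n (K * (A + T) + 1)

theorem fbd_nonneg {K T : ℝ} (hK : 0 ≤ K) (hT : 0 ≤ T) (n : ℕ) (A : ℝ) (hA : 0 ≤ A) :
    0 ≤ fbd K T n A := by
  induction n generalizing A with
  | zero => exact hA
  | succ n ih => exact ih _ (by positivity)

theorem foldm_bd {V : Type*} (G : SimpleGraph V)
    (μ : V → V → V → V) (K h0 : ℝ) (hK : 1 ≤ K)
    (h1 : ∀ a b : V, μ a a b = a)
    (hC1 : ∀ a b c a' b' c' : V, (G.dist (μ a b c) (μ a' b' c') : ℝ) ≤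
      K * (G.dist a a' + G.dist b b' + G.dist c c') + h0) (x0 y : V) (T l : ℝ)
    (hl : h0 ≤ l) (zs : List V) (hz : ∀ z ∈ zs, (G.dist y z : ℝ) ≤ T * l) (h : V) (A : ℝ)
    (hA : (G.dist y h : ℝ) ≤ A * l) :
    (G.dist y (foldm μ x0 zs h) : ℝ) ≤ fbd K T zs.length A * l := by
  induction zs generalizing h A with
  | nil => exact hA
  | cons z zs ih =>
    simp only [foldm, List.length_cons, fbd]
    apply ih (fun w hw => hz w (List.mem_cons_of_mem _ hw))
    have a := hC1 y y x0 h z x0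
    rw [h1] at a
    have b := hz z List.mem_cons_self
    simp only [SimpleGraph.dist_self, Nat.cast_zero] at a
    have := mul_le_mul_of_nonneg_left (add_le_add hA b) (by linarith : 0 ≤ K)
    nlinarith

theorem hub {V : Type*} (G : SimpleGraph V) (hconn : G.Connected)
    (μ : V → V → V → V) (η : ℕ) (K : ℝ) (H : ℕ → ℝ)
    (hK : 1 ≤ K) (hH : ∀ p : ℕ, 0 ≤ H p)
    (hcm : IsCoarseMedianRank (fun x y : V => (G.dist x y : ℝ)) μ K H η) (x0 : V)
    (ε : ℝ) (hε : 0 < ε) :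
    ∃ C c l0 : ℝ, 0 ≤ C ∧ 0 ≤ c ∧ ∀ l ≥ l0, ∀ y : V, ∃ h : V,
      (G.dist y h : ℝ) ≤ C * l ∧ (G.dist (μ y h x0) h : ℝ) ≤ c ∧
      ∀ w : V, (G.dist y (μ y w x0) : ℝ) ≤ (2 * K + 1) * l →
        (G.dist (μ y (μ y w x0) h) (μ y w x0) : ℝ) ≤ (K + 1) * (ε * l) + c := by
  classical
  have hK0 : 0 ≤ K := by linarith
  -- I1
  obtain ⟨κ, hκ0, hκ⟩ := transfer G hconn μ η K H hK hH hcm (ι := Fin 3)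
    (Tm.med (.var 0) (.med (.var 0) (.var 1) (.var 2)) (.var 2))
    (Tm.med (.var 0) (.var 1) (.var 2)) (by
      intro χ
      simp only [Tm.ev]
      rcases χ 0 <;> rcases χ 1 <;> rcases χ 2 <;> rfl)
  have hκ' : ∀ y w, (G.dist (μ y (μ y w x0) x0) (μ y w x0) : ℝ) ≤ κ := by
    intro y w
    simpa [Tm.ev] using hκ ![y, w, x0]
  obtain ⟨N, r0, hN⟩ := interval_bound G hconn μ η K H hK hH hcm ε (2 * (2 * K + 1)) κ hε
    (by linarith) hκ0
  -- fold terms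
  let ty : Tm (Fin N ⊕ Bool) := .var (.inr true)
  let tx : Tm (Fin N ⊕ Bool) := .var (.inr false)
  let tz : Fin N → Tm (Fin N ⊕ Bool) := fun i => .med ty (.var (.inl i)) tx
  let th : Tm (Fin N ⊕ Bool) := foldm Tm.med tx (List.ofFn tz) ty
  have e2 : ∀ i : Fin N, ∃ C : ℝ, 0 ≤ C ∧ ∀ v : Fin N ⊕ Bool → V,
      (G.dist ((Tm.med ty (tz i) th).ev μ v) ((tz i).ev μ v) : ℝ) ≤ C := by
    intro i
    refine transfer G hconn μ η K H hK hH hcm _ _ fun χ => ?_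
    simp only [Tm.ev, th, ev_foldm, ty]
    by_cases hne : χ (.inr true) = χ (.inr false)
    · have : (tz i).ev maj χ = χ (.inr true) := by
        simp only [tz, Tm.ev, ty, tx, ← hne]
        rcases χ (.inr true) <;> rcases χ (.inl i) <;> rfl
      rw [this]
      simp only [Tm.ev, tx, ← hne]
      rw [foldm_x0]
      rcases χ (.inr true) <;> rfl
    · apply foldm_bool _ _ hne
      exact List.mem_map_of_mem (List.mem_ofFn.2 ⟨i, rfl⟩)
  obtain ⟨c3, hc30, hc3⟩ := transfer G hconn μ η K H hK hH hcm (Tm.med ty th tx) th (by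
    intro χ
    simp only [Tm.ev, th, ev_foldm, ty, tx]
    apply foldm_bool2)
  choose c2 hc20 hc2 using e2
  have hsum : ∀ i, c2 i ≤ ∑ i, c2 i := fun i =>
    Finset.single_le_sum (fun i _ => hc20 i) (Finset.mem_univ i)
  have hsum0 : 0 ≤ ∑ i, c2 i := Finset.sum_nonneg (fun i _ => hc20 i)
  obtain ⟨h1, h2, hC1, -⟩ := hcm
  dsimp only at hC1
  have hH0 := hH 0
  refine ⟨fbd K (2 * K + 1) N 0, c3 + ∑ i, c2 i + H 0, max r0 (H 0),
    fbd_nonneg hK0 (by linarith) _ _ le_rfl, by positivity, fun l hl y => ?_⟩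
  have hlr : r0 ≤ l := le_trans (le_max_left _ _) hl
  have hlH : H 0 ≤ l := le_trans (le_max_right _ _) hl
  have hl0 : 0 ≤ l := hH0.trans hlH
  let S : Set V := {z | ∃ w, z = μ y w x0 ∧ (G.dist y z : ℝ) ≤ (2 * K + 1) * l}
  obtain ⟨g, hgS, hg⟩ := net (fun a b => (G.dist a b : ℝ)) (dsymm G) (by simp) (ε * l)
    (by positivity) S ⟨y, y, by rw [h1], by simp; positivity⟩ N (by
      intro E hE hsep
      apply hN l hlr y x0 E _ hsep
      · intro e he e' he'
        obtain ⟨_, _, a⟩ := hE e he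
        obtain ⟨_, _, b⟩ := hE e' he'
        have := tri G hconn e y e'
        rw [dsymm] at a
        linarith
      · intro e he
        obtain ⟨w, rfl, -⟩ := hE e he
        exact hκ' y w)
  choose w hw hgT using hgS
  let v : Fin N ⊕ Bool → V := Sum.elim w (fun b => if b then y else x0)
  have hty : ty.ev μ v = y := rfl
  have htx : tx.ev μ v = x0 := rfl
  have htz : ∀ i, (tz i).ev μ v = g i := fun i => by rw [hw i]; rfl
  have hth : th.ev μ v = foldm μ x0 (List.ofFn g) y := by
    simp only [th, ev_foldm, hty, htx]
    congr 1
    rw [List.map_ofFn]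
    congr 1
    funext i
    exact htz i
  refine ⟨foldm μ x0 (List.ofFn g) y, ?_, ?_, ?_⟩
  · have := foldm_bd G μ K (H 0) hK h1 hC1 x0 y (2 * K + 1) l hlH (List.ofFn g) (by
      intro z hz
      obtain ⟨i, rfl⟩ := List.mem_ofFn.1 hz
      exact hgT i) y 0 (by simp)
    simpa using this
  · have := hc3 v
    simp only [Tm.ev, hty, htx, hth] at this
    linarith
  · intro w' hw'
    obtain ⟨i, hi⟩ := hg (μ y w' x0) ⟨w', rfl, hw'⟩
    have a := hc2 i v
    simp only [Tm.ev, hty, htz, hth] at a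
    generalize foldm μ x0 (List.ofFn g) y = h at *
    generalize μ y w' x0 = m at *
    have b := hC1 y m h y (g i) h
    simp only [SimpleGraph.dist_self, Nat.cast_zero] at b
    have t1 := tri G hconn (μ y m h) (μ y (g i) h) m
    have t2 := tri G hconn (μ y (g i) h) (g i) m
    rw [dsymm G (g i) m] at t2
    have := mul_le_mul_of_nonneg_left hi hK0
    have := hsum i
    linarith

theorem multi {V : Type*} (G : SimpleGraph V) (hconn : G.Connected)
    (μ : V → V → V → V) (η : ℕ) (K : ℝ) (H : ℕ → ℝ)
    (hK : 1 ≤ K) (hH : ∀ p : ℕ, 0 ≤ H p)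
    (hcm : IsCoarseMedianRank (fun x y : V => (G.dist x y : ℝ)) μ K H η)
    (ε : ℝ) (hε : 0 < ε) :
    ∃ (C l0 : ℝ) (N : ℕ), 0 ≤ C ∧ ∀ l ≥ l0, ∃ h : V → V, (∀ y, (G.dist y (h y) : ℝ) ≤ C * l) ∧
      ∀ x, ∃ g : Fin N → V, ∀ y, (G.dist x y : ℝ) ≤ 2 * l →
        ∃ i, (G.dist (g i) (h y) : ℝ) ≤ (K * (K + 1) + 2) * (ε * l) := by
  classical
  have hK0 : 0 ≤ K := by linarith
  obtain ⟨x0⟩ := hconn.nonempty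
  obtain ⟨C, c, l0, hC, hc, hhub⟩ := hub G hconn μ η K H hK hH hcm x0 ε hε
  obtain ⟨c3, hc30, hc3⟩ := transfer G hconn μ η K H hK hH hcm (ι := Fin 4)
    (Tm.med (.med (.var 0) (.var 1) (.med (.var 0) (.var 2) (.var 3)))
      (.med (.var 0) (.var 2) (.var 3)) (.var 3))
    (Tm.med (.var 0) (.var 2) (.var 3)) (by
      intro χ
      simp only [Tm.ev]
      rcases χ 0 <;> rcases χ 1 <;> rcases χ 2 <;> rcases χ 3 <;> rfl)
  have hc3' : ∀ y m h, (G.dist (μ (μ y m (μ y h x0)) (μ y h x0) x0) (μ y h x0) : ℝ) ≤ c3 := by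
    intro y m h
    simpa [Tm.ev] using hc3 ![y, m, h, x0]
  obtain ⟨c4, hc40, hc4⟩ := transfer G hconn μ η K H hK hH hcm (ι := Fin 4)
    (Tm.med (.var 0) (.med (.med (.var 0) (.var 1) (.var 3)) (.var 2) (.var 3)) (.var 3))
    (Tm.med (.med (.var 0) (.var 1) (.var 3)) (.var 2) (.var 3)) (by
      intro χ
      simp only [Tm.ev]
      rcases χ 0 <;> rcases χ 1 <;> rcases χ 2 <;> rcases χ 3 <;> rfl)
  have hc4' : ∀ x y h, (G.dist (μ x (μ (μ x y x0) h x0) x0) (μ (μ x y x0) h x0) : ℝ) ≤ c4 := by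
    intro x y h
    simpa [Tm.ev] using hc4 ![x, y, h, x0]
  obtain ⟨N, r0, hN⟩ := interval_bound G hconn μ η K H hK hH hcm ε
    (2 * (2 + C + (K * (K + 1) + 1) * ε)) c4 hε (by positivity) hc40
  obtain ⟨h1, h2, hC1, -⟩ := hcm
  dsimp only at hC1
  have hH0 := hH 0
  let Q : ℝ := c + c3 + K * (K * c + H 0 + c + c) + H 0
  refine ⟨C, max (max l0 r0) (max (H 0) (Q / ε)), N, hC, fun l hl => ?_⟩
  have hl1 : l0 ≤ l := le_trans (le_trans (le_max_left _ _) (le_max_left _ _)) hl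
  have hl2 : r0 ≤ l := le_trans (le_trans (le_max_right _ _) (le_max_left _ _)) hl
  have hl3 : H 0 ≤ l := le_trans (le_trans (le_max_left _ _) (le_max_right _ _)) hl
  have hl4 : Q / ε ≤ l := le_trans (le_trans (le_max_right _ _) (le_max_right _ _)) hl
  have hl0 : 0 ≤ l := hH0.trans hl3
  have hQ : Q ≤ ε * l := by rw [div_le_iff₀ hε] at hl4; linarith
  choose h hh1 hh2 hh3 using hhub l hl1
  refine ⟨h, hh1, fun x => ?_⟩
  have hu : ∀ y, (G.dist x y : ℝ) ≤ 2 * l →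
      (G.dist (h y) (μ (μ x y x0) (h y) x0) : ℝ) ≤ (K * (K + 1) + 1) * (ε * l) := by
    intro y hy
    have hm : μ x y x0 = μ y x x0 := (h2 x y x0).2.1
    have a0 : (G.dist y (μ y x x0) : ℝ) ≤ (2 * K + 1) * l := by
      have := hC1 y y x0 y x x0
      rw [h1] at this
      simp only [SimpleGraph.dist_self, Nat.cast_zero] at this
      rw [dsymm G y x] at this
      have := mul_le_mul_of_nonneg_left hy hK0
      linarith
    have a1 := hh3 y x a0
    have a2 := hh2 y
    rw [hm]
    generalize μ y x x0 = m at *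
    generalize h y = hy' at *
    have a3 := hc3' y m hy'
    generalize μ y hy' x0 = hh at *
    have b1 := hC1 y m hh y m hy'
    have b2 := hC1 (μ y m hh) hh x0 m hy' x0
    simp only [SimpleGraph.dist_self, Nat.cast_zero] at b1 b2
    have t1 := tri G hconn (μ y m hh) (μ y m hy') m
    have t2 := tri G hconn hy' hh (μ m hy' x0)
    have t3 := tri G hconn hh (μ (μ y m hh) hh x0) (μ m hy' x0)
    rw [dsymm G hy' hh] at t2
    rw [dsymm G hh (μ (μ y m hh) hh x0)] at t3
    have m1 := mul_le_mul_of_nonneg_left a2 hK0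
    have m2 : K * ((G.dist (μ y m hh) m : ℝ) + G.dist hh hy') ≤
        K * (K * c + H 0 + ((K + 1) * (ε * l) + c) + c) :=
      mul_le_mul_of_nonneg_left (by linarith) hK0
    simp only [Q] at hQ
    linarith
  let S : Set V := {u | ∃ y, (G.dist x y : ℝ) ≤ 2 * l ∧ u = μ (μ x y x0) (h y) x0}
  have hSd : ∀ u ∈ S, (G.dist x u : ℝ) ≤ (2 + C + (K * (K + 1) + 1) * ε) * l := by
    rintro u ⟨y, hy, rfl⟩
    have := hu y hy
    have t1 := tri G hconn x y (μ (μ x y x0) (h y) x0)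
    have t2 := tri G hconn y (h y) (μ (μ x y x0) (h y) x0)
    have := hh1 y
    linarith
  obtain ⟨g, -, hg⟩ := net (fun a b => (G.dist a b : ℝ)) (dsymm G) (by simp) (ε * l)
    (by positivity) S ⟨_, x, by simp; positivity, rfl⟩ N (by
      intro E hE hsep
      apply hN l hl2 x x0 E _ hsep
      · intro e he e' he'
        have a := hSd e (hE e he)
        have b := hSd e' (hE e' he')
        have := tri G hconn e x e'
        rw [dsymm] at a
        linarith
      · intro e he
        obtain ⟨y, -, rfl⟩ := hE e he
        exact hc4' x y (h y))
  refine ⟨g, fun y hy => ?_⟩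
  obtain ⟨i, hi⟩ := hg _ ⟨y, hy, rfl⟩
  refine ⟨i, ?_⟩
  have := hu y hy
  have t := tri G hconn (g i) (μ (μ x y x0) (h y) x0) (h y)
  rw [dsymm G (g i) (μ (μ x y x0) (h y) x0), dsymm G (μ (μ x y x0) (h y) x0) (h y)] at t
  linarith

end CMProof

namespace CMProof
open CoarseMedian AsdimGrowth

theorem ad_bound {V : Type*} (G : SimpleGraph V)
    (hconn : G.Connected)
    (c₀ c : ℝ) (hc₀ : 0 < c₀) (hc : 1 < c)
    (hgrowth : ∀ x : V, ∀ r : ℝ, 1 ≤ r →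
      {y : V | (G.dist x y : ℝ) ≤ r}.encard ≤ ENNReal.ofReal (c₀ * c ^ r))
    (μ : V → V → V → V) (η : ℕ) (K : ℝ) (H : ℕ → ℝ)
    (hK : 1 ≤ K) (hH : ∀ p : ℕ, 0 ≤ H p)
    (hcm : IsCoarseMedianRank (fun x y : V => (G.dist x y : ℝ)) μ K H η)
    (δ : ℝ) (hδ : 0 < δ) :
    ∃ l0 : ℝ, ∀ l ≥ l0, ∃ n : ℕ, adFun (fun x y : V => (G.dist x y : ℝ)) l ≤ n ∧
      (n : ℝ) ≤ Real.exp (δ * l) := by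
  classical
  have hK0 : 0 ≤ K := by linarith
  have hlc : 0 < Real.log c := Real.log_pos hc
  let B : ℝ := K * (K + 1) + 2
  have hB : 0 < B := by positivity
  let ε : ℝ := δ / (2 * Real.log c * B)
  have hε : 0 < ε := by positivity
  obtain ⟨C, l0, N, hC, hmain⟩ := multi G hconn μ η K H hK hH hcm ε hε
  refine ⟨max (max l0 1) (max (1 / (B * ε)) (2 * (N * c₀) / δ)), fun l hl => ?_⟩
  have hl1 : l0 ≤ l := le_trans (le_trans (le_max_left _ _) (le_max_left _ _)) hl
  have hl2 : 1 ≤ l := le_trans (le_trans (le_max_right _ _) (le_max_left _ _)) hl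
  have hl3 : 1 / (B * ε) ≤ l := le_trans (le_trans (le_max_left _ _) (le_max_right _ _)) hl
  have hl4 : 2 * (N * c₀) / δ ≤ l := le_trans (le_trans (le_max_right _ _) (le_max_right _ _)) hl
  obtain ⟨h, hh, hx⟩ := hmain l hl1
  let R : ℝ := B * (ε * l)
  have hR : 1 ≤ R := by
    rw [div_le_iff₀ (by positivity)] at hl3
    simp only [R]; linarith
  let q : ℝ := c₀ * c ^ R
  have hq : 0 ≤ q := by positivity
  have hball : ∀ x : V, {y : V | (G.dist x y : ℝ) ≤ R}.encard ≤ (⌊q⌋₊ : ℕ∞) := by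
    intro x
    have := hgrowth x R hR
    generalize {y : V | (G.dist x y : ℝ) ≤ R}.encard = e at *
    induction e with
    | top => simp at this
    | coe e =>
      have h2 : ((e : ℕ) : ENNReal) ≤ ENNReal.ofReal q := by simpa using this
      rw [← ENNReal.ofReal_natCast, ENNReal.ofReal_le_ofReal_iff hq] at h2
      exact_mod_cast Nat.le_floor h2
  let W : V → Set V := fun z => {x | ∃ y, (G.dist x y : ℝ) ≤ 2 * l ∧ h y = z}
  let U : Set (Set V) := {u | ∃ y, u = W (h y)}
  have hmult : mult U ≤ ((N * ⌊q⌋₊ : ℕ) : ℕ∞) := by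
    refine iSup_le fun x => ?_
    obtain ⟨g, hg⟩ := hx x
    have hsub : {u | u ∈ U ∧ x ∈ u} ⊆ W '' (⋃ i, {y : V | (G.dist (g i) y : ℝ) ≤ R}) := by
      rintro u ⟨⟨y0, rfl⟩, y, hy, hyz⟩
      obtain ⟨i, hi⟩ := hg y hy
      refine ⟨h y0, Set.mem_iUnion.2 ⟨i, ?_⟩, rfl⟩
      rw [← hyz]
      exact hi
    refine (Set.encard_le_encard hsub).trans ((Set.encard_image_le _ _).trans ?_)
    have hfin : ∀ F : Finset (Fin N), (⋃ i ∈ F, {y : V | (G.dist (g i) y : ℝ) ≤ R}).encard ≤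
        ((F.card * ⌊q⌋₊ : ℕ) : ℕ∞) := by
      intro F
      induction F using Finset.induction_on with
      | empty => simp
      | insert a F ha ih =>
        rw [Finset.set_biUnion_insert, Finset.card_insert_of_notMem ha]
        refine (Set.encard_union_le _ _).trans ((add_le_add (hball (g a)) ih).trans ?_)
        push_cast
        exact le_of_eq (by ring)
    simpa using hfin Finset.univ
  refine ⟨N * ⌊q⌋₊, ?_, ?_⟩
  · suffices hU : IsCover U ∧ UnifBdd (fun x y : V => (G.dist x y : ℝ)) U ∧
        LebGT (fun x y : V => (G.dist x y : ℝ)) U l by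
      unfold adFun
      refine le_trans tsub_le_self (le_trans (sInf_le ?_) hmult)
      exact ⟨U, hU.1, hU.2.1, hU.2.2, rfl⟩
    refine ⟨?_, ?_, ?_⟩
    · intro x
      exact ⟨W (h x), ⟨x, rfl⟩, x, by simp; linarith, rfl⟩
    · refine ⟨2 * (2 * l + C * l), ?_⟩
      have aux : ∀ z, ∀ a ∈ W z, (G.dist a z : ℝ) ≤ 2 * l + C * l := by
        rintro z a ⟨y, hy, rfl⟩
        have := tri G hconn a y (h y)
        linarith [hh y]
      rintro u ⟨y, rfl⟩ a ha b hb
      have h1 := aux _ a ha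
      have h2 := aux _ b hb
      rw [dsymm] at h2
      have := tri G hconn a (h y) b
      show (G.dist a b : ℝ) ≤ _
      linarith
    · refine ⟨2 * l, by linarith, fun A hA => ?_⟩
      rcases A.eq_empty_or_nonempty with rfl | ⟨x, hxA⟩
      · obtain ⟨y⟩ := hconn.nonempty
        exact ⟨W (h y), ⟨y, rfl⟩, Set.empty_subset _⟩
      · exact ⟨W (h x), ⟨x, rfl⟩, fun a ha => ⟨x, hA a ha x hxA, rfl⟩⟩
  · have h1 : (⌊q⌋₊ : ℝ) ≤ q := Nat.floor_le hq
    have h2 : c ^ R = Real.exp (δ * l / 2) := by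
      rw [Real.rpow_def_of_pos (by linarith)]
      congr 1
      simp only [R, ε]
      field_simp
    have h3 : (N : ℝ) * c₀ ≤ Real.exp (δ * l / 2) := by
      rw [div_le_iff₀ hδ] at hl4
      have := Real.add_one_le_exp (δ * l / 2)
      linarith
    push_cast
    calc (N : ℝ) * ⌊q⌋₊ ≤ N * q := by gcongr
      _ = (N * c₀) * Real.exp (δ * l / 2) := by simp only [q, h2]; ring
      _ ≤ Real.exp (δ * l / 2) * Real.exp (δ * l / 2) := by gcongr
      _ = Real.exp (δ * l) := by rw [← Real.exp_add]; congr 1; ring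

theorem ad_mono {V : Type*} (d : V → V → ℝ) {a b : ℝ} (hab : a ≤ b) :
    adFun d a ≤ adFun d b := by
  refine tsub_le_tsub_right (sInf_le_sInf ?_) _
  rintro m ⟨U, h1, h2, ⟨l, hl, h3⟩, h4⟩
  exact ⟨U, h1, h2, ⟨l, lt_of_le_of_lt hab hl, h3⟩, h4⟩

end CMProof

open AsdimGrowth CoarseMedian

/-- Let `V` be the vertex set of a connected simple graph with the
edge-path metric `ρ`, uniformly locally finite with at most exponential volume growth
(every closed ball of radius `r ≥ 1` has at most `c₀·c^r` points), and let `μ` be a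
coarse median on `(V,ρ)` of rank at most `η`. Then `V` has subexponential asymptotic
dimension growth: there is `f : ℝ₊ → ℝ₊` with `ad_V ⪯ f` and `log(f(r))/r → 0` as
`r → ∞`. -/
theorem coarse_median_subexp_asdim_growth {V : Type*} (G : SimpleGraph V)
    (hconn : G.Connected)
    (c₀ c : ℝ) (hc₀ : 0 < c₀) (hc : 1 < c)
    (hgrowth : ∀ x : V, ∀ r : ℝ, 1 ≤ r →
      {y : V | (G.dist x y : ℝ) ≤ r}.encard ≤ ENNReal.ofReal (c₀ * c ^ r))
    (μ : V → V → V → V) (η : ℕ) (K : ℝ) (H : ℕ → ℝ)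
    (hK : 1 ≤ K) (hH : ∀ p : ℕ, 0 ≤ H p)
    (hcm : IsCoarseMedianRank (fun x y : V => (G.dist x y : ℝ)) μ K H η) :
    ∃ f : ℝ → ℝ, (∀ x : ℝ, 0 ≤ f x) ∧
      FDom (adFunE (fun x y : V => (G.dist x y : ℝ)))
        (fun x => ENNReal.ofReal (f x)) ∧
      Filter.Tendsto (fun r : ℝ => Real.log (f r) / r) Filter.atTop (nhds 0) := by
  have hb := CMProof.ad_bound G hconn c₀ c hc₀ hc hgrowth μ η K H hK hH hcm
  set d : V → V → ℝ := fun x y : V => (G.dist x y : ℝ) with hd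
  have hfin : ∀ x, adFun d x ≠ ⊤ := by
    intro x
    obtain ⟨l0, hl0⟩ := hb 1 one_pos
    obtain ⟨n, hn, -⟩ := hl0 (max x l0) (le_max_right _ _)
    exact ne_top_of_le_ne_top (ENat.natCast_ne_top n)
      ((CMProof.ad_mono d (le_max_left x l0)).trans hn)
  refine ⟨fun x => ((adFun d x).toNat : ℝ), fun x => by positivity, ⟨1, fun x hx => ?_⟩, ?_⟩
  · have h1 : adFun d x ≤ ((adFun d (x + 1)).toNat : ℕ∞) := by
      rw [ENat.natCast_toNat (hfin _)]
      exact CMProof.ad_mono d (by linarith)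
    have h2 : adFunE d x ≤ ENNReal.ofReal ((adFun d (x + 1)).toNat : ℝ) := by
      rw [ENNReal.ofReal_natCast]
      unfold adFunE
      exact_mod_cast h1
    simp only [Nat.cast_one, one_mul]
    exact h2.trans le_self_add
  · rw [Metric.tendsto_atTop]
    intro e he
    obtain ⟨l0, hl0⟩ := hb (e / 2) (half_pos he)
    refine ⟨max l0 1, fun r hr => ?_⟩
    have hr1 : l0 ≤ r := le_trans (le_max_left _ _) hr
    have hr2 : 1 ≤ r := le_trans (le_max_right _ _) hr
    obtain ⟨n, hn, hne⟩ := hl0 r hr1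
    have hle : (adFun d r).toNat ≤ n := ENat.toNat_le_of_le_natCast hn
    have h0 : 0 ≤ Real.log ((adFun d r).toNat : ℝ) := Real.log_natCast_nonneg _
    have h1 : Real.log ((adFun d r).toNat : ℝ) ≤ e / 2 * r := by
      rcases Nat.eq_zero_or_pos (adFun d r).toNat with hz | hz
      · rw [hz]; simp; positivity
      · rw [Real.log_le_iff_le_exp (by exact_mod_cast hz)]
        exact le_trans (by exact_mod_cast hle) hne
    rw [Real.dist_eq, sub_zero, abs_of_nonneg (div_nonneg h0 (by linarith)), div_lt_iff₀ (by linarith)]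
    nlinarith
end
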